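/- Under the stated hypotheses, the Orbit 4 (K,L,L) three-term relation holds: S(d−c)·A(1−a, e−a, f−a, g−a)·A(1−a, 1−b, 1−c, 1−d)·A(b, 1+b−e, 1+b−f, 1+b−g)·K(a;b,c,d;e,f,g) − A(1−c, e−c, f−c, g−c)·B_1(a,b,d,c,e,f,g)·L(1−a, e−a, f−a, g−a; 1+d−a; 1+c−a, 1+b−a) + A(1−d, e−d, f−d, g−d)·B_1(a,b,c,d,e,f,g)·L(1−a, e−a, f−a, g−a; 1+c−a; 1+b−a, 1+d−a) = 0. Here B_1(a,b,d,c,e,f,g) denotes B_1 evaluated with its third and fourth arguments interchanged, i.e. π^{−4}·S(b,d)·(S(b−a,d−a,c) + S(e−a,f−a,g−a)). -/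

import Mathlib

noncomputable section

open Complex

/-- `Sn x = sin (π x)`. -/
def Sn (x : ℂ) : ℂ := Complex.sin ((Real.pi : ℂ) * x)

/-- The renormalized Saalschützian series
`F*(a,b,c,d;e,f,g) = ∑ₖ Γ(k+a)Γ(k+b)Γ(k+c)Γ(k+d)/(k!·Γ(k+e)Γ(k+f)Γ(k+g))`. -/
def Fstar (a b c d e f g : ℂ) : ℂ :=
  ∑' k : ℕ, (Complex.Gamma (k + a) * Complex.Gamma (k + b) *
      Complex.Gamma (k + c) * Complex.Gamma (k + d)) /
    ((k.factorial : ℂ) * Complex.Gamma (k + e) * Complex.Gamma (k + f) *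
      Complex.Gamma (k + g))

/-- The function `K(a;b,c,d;e,f,g)`. -/
def Kf (a b c d e f g : ℂ) : ℂ :=
  (Fstar a b c d e f g +
      Fstar a (1 + a - e) (1 + a - f) (1 + a - g) (1 + a - b) (1 + a - c) (1 + a - d)) /
    (Sn a * Complex.Gamma a ^ 2 * Complex.Gamma b * Complex.Gamma c * Complex.Gamma d *
      Complex.Gamma (1 + a - e) * Complex.Gamma (1 + a - f) * Complex.Gamma (1 + a - g))

/-- The function `L(a,b,c,d;e;f,g)`. -/
def Lf (a b c d e f g : ℂ) : ℂ :=
  (Fstar a b c d e f g -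
      Fstar (1 + a - e) (1 + b - e) (1 + c - e) (1 + d - e) (2 - e) (1 + f - e) (1 + g - e)) /
    (Sn e * Complex.Gamma a * Complex.Gamma b * Complex.Gamma c * Complex.Gamma d *
      Complex.Gamma (1 + a - e) * Complex.Gamma (1 + b - e) * Complex.Gamma (1 + c - e) *
      Complex.Gamma (1 + d - e))

/-- `A(x,y,z,t) = 1/(Γ(x)Γ(y)Γ(z)Γ(t))`. -/
def Af (x y z t : ℂ) : ℂ :=
  1 / (Complex.Gamma x * Complex.Gamma y * Complex.Gamma z * Complex.Gamma t)

def B1 (a b c d e f g : ℂ) : ℂ :=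
  Sn b * Sn c * (Sn (b - a) * Sn (c - a) * Sn d + Sn (e - a) * Sn (f - a) * Sn (g - a)) /
    (Real.pi : ℂ) ^ 4

def B2 (a b c d e f g : ℂ) : ℂ :=
  Sn (f - a) * Sn (g - a) *
    (Sn (b - a) * Sn (c - a) * Sn (d - a) + Sn (e - 2 * a) * Sn (f - a) * Sn (g - a)) /
    (Real.pi : ℂ) ^ 4

def B3 (a b c d e f g : ℂ) : ℂ :=
  (Sn f * Sn (f - e) * Sn (g - a) * Sn (g - b) * Sn (g - c) * Sn (g - d) -
      Sn g * Sn (g - e) * Sn (f - a) * Sn (f - b) * Sn (f - c) * Sn (f - d)) /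
    ((Real.pi : ℂ) ^ 4 * Sn (f - g))

def B4 (a b c d e f g : ℂ) : ℂ :=
  Sn (f - a) * Sn (g - a) * (Sn b * Sn c * Sn d + Sn (e - a) * Sn f * Sn g) /
    (Real.pi : ℂ) ^ 4

def B5 (a b c d e f g : ℂ) : ℂ :=
  Sn b * Sn (e - b) *
    (Sn (b - a) * Sn (c - a) * Sn (d - a) + Sn (e - 2 * a) * Sn (f - a) * Sn (g - a)) /
    (Real.pi : ℂ) ^ 4

def Cf (a b c d e f g : ℂ) : ℂ :=
  Sn (e - a) * (Sn b * Sn c * Sn d * B2 a b c d e f g +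
      Sn e * Sn (f - a) * Sn (g - a) * B4 a b c d e f g) / (Real.pi : ℂ) ^ 4

open Filter Topology

theorem tendsto_Gamma_nat_add_aux (m : ℕ) : ∀ s : ℂ, -(m : ℝ) < s.re →
    Tendsto (fun n : ℕ => Gamma (n + s) / (n.factorial * (n : ℂ) ^ (s - 1))) atTop (𝓝 1) := by
  have hlim (s : ℂ) : Tendsto (fun n : ℕ => (n : ℂ) / (n + s)) atTop (𝓝 1) := by
    simpa using tendsto_natCast_div_add_atTop (𝕜 := ℂ) s
  induction m with
  | zero =>
    intro s hs
    simp only [CharP.cast_eq_zero, neg_zero] at hs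
    have h0 : Gamma s ≠ 0 := Gamma_ne_zero_of_re_pos hs
    have h1 := ((GammaSeq_tendsto_Gamma s).inv₀ h0).const_mul (Gamma s)
    rw [mul_inv_cancel₀ h0] at h1
    have h2 := h1.mul (hlim s)
    rw [mul_one] at h2
    refine h2.congr' ?_
    filter_upwards [eventually_gt_atTop 0] with n hn
    have hn' : (n : ℂ) ≠ 0 := by exact_mod_cast hn.ne'
    have hre (j : ℕ) : s + j ≠ 0 := by
      intro h
      have := congrArg Complex.re h
      simp at this
      have : (0:ℝ) ≤ j := Nat.cast_nonneg j
      linarith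
    have hprod (k : ℕ) : Gamma (k + s) = Gamma s * ∏ j ∈ Finset.range k, (s + j) := by
      induction k with
      | zero => simp
      | succ k ih =>
        rw [Finset.prod_range_succ, ← mul_assoc, ← ih,
          show ((k + 1 : ℕ) : ℂ) + s = (k + s) + 1 by push_cast; ring,
          Gamma_add_one _ (by rw [add_comm]; exact hre k)]
        ring
    have hp : ∏ j ∈ Finset.range n, (s + (j : ℂ)) ≠ 0 :=
      Finset.prod_ne_zero_iff.mpr fun j _ => hre j
    rw [hprod n, GammaSeq, Finset.prod_range_succ, cpow_sub _ _ hn', cpow_one]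
    have hf : (n.factorial : ℂ) ≠ 0 := by exact_mod_cast n.factorial_ne_zero
    have hc : (n : ℂ) ^ s ≠ 0 := by simp [cpow_eq_zero_iff, hn']
    have := hre n
    have : (n : ℂ) + s ≠ 0 := by rw [add_comm]; exact this
    field_simp
    ring
  | succ m ih =>
    intro s hs
    have h := ih (s + 1) (by push_cast at hs; simp; linarith)
    have h2 := h.mul (hlim s)
    rw [mul_one] at h2
    refine h2.congr' ?_
    have hlarge : ∀ᶠ n : ℕ in atTop, ‖s‖ < n := by
      obtain ⟨N, hN⟩ := exists_nat_gt ‖s‖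
      filter_upwards [eventually_ge_atTop N] with n hn
      exact hN.trans_le (by exact_mod_cast hn)
    filter_upwards [eventually_gt_atTop 0, hlarge] with n hn hl
    have hn' : (n : ℂ) ≠ 0 := by exact_mod_cast hn.ne'
    have hns : (n : ℂ) + s ≠ 0 := by
      intro h
      have : s = -(n : ℂ) := by linear_combination h
      rw [this] at hl; simp at hl
    rw [← add_assoc, Gamma_add_one _ hns, cpow_sub _ _ hn', cpow_sub _ _ hn', cpow_add _ _ hn', cpow_one]
    have hf : (n.factorial : ℂ) ≠ 0 := by exact_mod_cast n.factorial_ne_zero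
    have hc : (n : ℂ) ^ s ≠ 0 := by simp [cpow_eq_zero_iff, hn']
    field_simp

theorem tendsto_Gamma_nat_add (s : ℂ) :
    Tendsto (fun n : ℕ => Gamma (n + s) / (n.factorial * (n : ℂ) ^ (s - 1))) atTop (𝓝 1) := by
  obtain ⟨m, hm⟩ := exists_nat_gt (-s.re)
  exact tendsto_Gamma_nat_add_aux m s (by linarith)

theorem tendsto_Gamma_ratio (a b : ℂ) :
    Tendsto (fun n : ℕ => Gamma (n + a) / Gamma (n + b) * (n : ℂ) ^ (b - a)) atTop (𝓝 1) := by
  have h := (tendsto_Gamma_nat_add a).div (tendsto_Gamma_nat_add b) one_ne_zero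
  rw [div_one] at h
  refine h.congr' ?_
  filter_upwards [eventually_gt_atTop 0] with n hn
  have hn' : (n : ℂ) ≠ 0 := by exact_mod_cast hn.ne'
  have hf : (n.factorial : ℂ) ≠ 0 := by exact_mod_cast n.factorial_ne_zero
  simp only [Pi.div_apply]
  rw [cpow_sub _ _ hn', cpow_sub _ _ hn', cpow_sub _ _ hn', cpow_one]
  have hc : (n : ℂ) ^ a ≠ 0 := by simp [cpow_eq_zero_iff, hn']
  have hc : (n : ℂ) ^ b ≠ 0 := by simp [cpow_eq_zero_iff, hn']
  field_simp

theorem Gamma_ratio_isBigO (a b : ℂ) :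
    (fun n : ℕ => Gamma (n + a) / Gamma (n + b)) =O[atTop] fun n : ℕ => (n : ℝ) ^ (a - b).re := by
  have h1 := (tendsto_Gamma_ratio a b).isBigO_one ℝ
  have h2 : (fun n : ℕ => (n : ℂ) ^ (a - b)) =O[atTop] fun n : ℕ => (n : ℝ) ^ (a - b).re := by
    refine Asymptotics.IsBigO.of_bound 1 ?_
    filter_upwards [eventually_gt_atTop 0] with n hn
    rw [norm_natCast_cpow_of_pos hn, one_mul]
    exact le_abs_self _
  refine (h1.mul h2).congr' ?_ (by simp)
  filter_upwards [eventually_gt_atTop 0] with n hn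
  have hn' : (n : ℂ) ≠ 0 := by exact_mod_cast hn.ne'
  rw [mul_assoc, ← cpow_add _ _ hn']
  simp

theorem summable_norm_of_isBigO_rpow {u : ℕ → ℂ} {p : ℝ} (hp : p < -1)
    (hu : u =O[atTop] fun n : ℕ => (n : ℝ) ^ p) : Summable fun n => ‖u n‖ :=
  summable_of_isBigO_nat (Real.summable_nat_rpow.2 hp) hu.norm_left

/-- Eventual multiplication of asymptotics `n ^ p`. -/
theorem isBigO_rpow_mul {u v : ℕ → ℂ} {p q : ℝ}
    (hu : u =O[atTop] fun n : ℕ => (n : ℝ) ^ p) (hv : v =O[atTop] fun n : ℕ => (n : ℝ) ^ q) :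
    (fun n => u n * v n) =O[atTop] fun n : ℕ => (n : ℝ) ^ (p + q) := by
  refine (hu.mul hv).congr' EventuallyEq.rfl ?_
  filter_upwards [eventually_gt_atTop 0] with n hn
  rw [Real.rpow_add (by exact_mod_cast hn)]

theorem tendsto_rpow_cpow_mul {u v : ℕ → ℂ} {p q l m : ℂ}
    (hu : Tendsto (fun n : ℕ => u n * (n : ℂ) ^ p) atTop (𝓝 l))
    (hv : Tendsto (fun n : ℕ => v n * (n : ℂ) ^ q) atTop (𝓝 m)) :
    Tendsto (fun n : ℕ => u n * v n * (n : ℂ) ^ (p + q)) atTop (𝓝 (l * m)) := by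
  refine (hu.mul hv).congr' ?_
  filter_upwards [eventually_gt_atTop 0] with n hn
  have hn' : (n : ℂ) ≠ 0 := by exact_mod_cast hn.ne'
  rw [cpow_add _ _ hn']; ring

theorem tendsto_zero_of_cpow {u : ℕ → ℂ} {p l : ℂ} (hp : 0 < p.re)
    (hu : Tendsto (fun n : ℕ => u n * (n : ℂ) ^ p) atTop (𝓝 l)) :
    Tendsto u atTop (𝓝 0) := by
  have h2 : Tendsto (fun n : ℕ => (n : ℂ) ^ (-p)) atTop (𝓝 0) := by
    rw [tendsto_zero_iff_norm_tendsto_zero]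
    have h3 := (tendsto_rpow_neg_atTop hp).comp (tendsto_natCast_atTop_atTop (R := ℝ))
    refine h3.congr' ?_
    filter_upwards [eventually_gt_atTop 0] with n hn
    rw [norm_natCast_cpow_of_pos hn]; simp
  have h := hu.mul h2
  rw [mul_zero] at h
  refine h.congr' ?_
  filter_upwards [eventually_gt_atTop 0] with n hn
  have hn' : (n : ℂ) ≠ 0 := by exact_mod_cast hn.ne'
  rw [mul_assoc, ← cpow_add _ _ hn']; simp

theorem eq_of_recurrence {X Y p q w : ℕ → ℂ} {l : ℂ} (hl : l ≠ 0) (hq : ∀ n, q n ≠ 0)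
    (hX : ∀ n, p n * X (n + 1) = q n * X n) (hY : ∀ n, p n * Y (n + 1) = q n * Y n)
    (hXl : Tendsto (fun n => X n * w n) atTop (𝓝 l))
    (hYl : Tendsto (fun n => Y n * w n) atTop (𝓝 l)) : X 0 = Y 0 := by
  by_cases hp : ∀ n, p n ≠ 0
  swap
  · push Not at hp
    obtain ⟨n, hn⟩ := hp
    have hz {Z : ℕ → ℂ} (hZ : ∀ n, p n * Z (n + 1) = q n * Z n) : Z 0 = 0 := by
      have hback : ∀ m, Z m = 0 → Z 0 = 0 := by
        intro m
        induction m with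
        | zero => exact id
        | succ m ih =>
          intro h
          have := hZ m
          rw [h, mul_zero] at this
          exact ih ((mul_eq_zero.1 this.symm).resolve_left (hq m))
      have := hZ n
      rw [hn, zero_mul] at this
      exact hback n ((mul_eq_zero.1 this.symm).resolve_left (hq n))
    rw [hz hX, hz hY]
  have hstep (n : ℕ) : X 0 * Y n = Y 0 * X n := by
    induction n with
    | zero => ring
    | succ n ih =>
      apply mul_left_cancel₀ (hp n)
      linear_combination X 0 * hY n - Y 0 * hX n + q n * ih
  have h1 := hYl.const_mul (X 0)
  have h2 := hXl.const_mul (Y 0)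
  have h3 := tendsto_nhds_unique (h1.congr fun n => by rw [← mul_assoc, hstep, mul_assoc]) h2
  exact mul_right_cancel₀ hl h3

theorem tsum_eq_of_telescope {f R : ℕ → ℂ} {l : ℂ} (hf : Summable f)
    (hR : ∀ k, f k = R (k + 1) - R k) (hl : Tendsto R atTop (𝓝 l)) : ∑' k, f k = l - R 0 := by
  have h1 := hf.hasSum.tendsto_sum_nat
  have h2 : Tendsto (fun n => ∑ k ∈ Finset.range n, f k) atTop (𝓝 (l - R 0)) := by
    refine (hl.sub_const (R 0)).congr fun n => ?_
    rw [Finset.sum_congr rfl fun k _ => hR k, Finset.sum_range_sub]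
  exact tendsto_nhds_unique h1 h2

theorem Gamma_inv_eq (s : ℂ) : (Gamma s)⁻¹ = s * (Gamma (s + 1))⁻¹ := by
  simpa using one_div_Gamma_eq_self_mul_one_div_Gamma_add_one s

def gaussTerm (a b c : ℂ) (k : ℕ) : ℂ :=
  Gamma (k + a) * Gamma (k + b) / (k.factorial * Gamma (k + c))

theorem gaussTerm_eq_ratio (a b c : ℂ) (k : ℕ) :
    gaussTerm a b c k = Gamma (k + a) / Gamma (k + 1) * (Gamma (k + b) / Gamma (k + c)) := by
  rw [gaussTerm, Gamma_nat_eq_factorial]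
  ring

theorem gaussTerm_tendsto (a b c : ℂ) :
    Tendsto (fun n : ℕ => gaussTerm a b c n * (n : ℂ) ^ (1 - a + (c - b))) atTop (𝓝 1) := by
  simp_rw [gaussTerm_eq_ratio]
  simpa using tendsto_rpow_cpow_mul (tendsto_Gamma_ratio a 1) (tendsto_Gamma_ratio b c)

theorem gaussTerm_isBigO (a b c : ℂ) :
    gaussTerm a b c =O[atTop] fun n : ℕ => (n : ℝ) ^ (a + b - c - 1).re := by
  have h := isBigO_rpow_mul (Gamma_ratio_isBigO a 1) (Gamma_ratio_isBigO b c)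
  have e : (a - 1).re + (b - c).re = (a + b - c - 1).re := by simp; ring
  rw [e] at h
  exact h.congr_left fun n => (gaussTerm_eq_ratio a b c n).symm

theorem gaussTerm_summable_norm {a b c : ℂ} (h : 0 < (c - a - b).re) :
    Summable fun k => ‖gaussTerm a b c k‖ :=
  summable_norm_of_isBigO_rpow (by simp at h ⊢; linarith) (gaussTerm_isBigO a b c)

theorem ne_zero_of_add_nat {a : ℂ} (ha : ∀ n : ℤ, a ≠ n) (k : ℕ) : (k : ℂ) + a ≠ 0 := by
  intro h
  apply ha (-k)
  push_cast
  linear_combination h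

theorem gaussTerm_telescope {a b : ℂ} (ha : ∀ n : ℤ, a ≠ n) (hb : ∀ n : ℤ, b ≠ n) (c : ℂ) (k : ℕ) :
    (c - a) * (c - b) * gaussTerm a b (c + 1) k - (c - a - b) * gaussTerm a b c k =
      (k + 1 : ℕ) * gaussTerm a b c (k + 1) - k * gaussTerm a b c k := by
  have h1 : Gamma ((k + 1 : ℕ) + a) = (k + a) * Gamma (k + a) := by
    rw [← Gamma_add_one _ (ne_zero_of_add_nat ha k)]; congr 1; push_cast; ring
  have h2 : Gamma ((k + 1 : ℕ) + b) = (k + b) * Gamma (k + b) := by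
    rw [← Gamma_add_one _ (ne_zero_of_add_nat hb k)]; congr 1; push_cast; ring
  have h3 : (Gamma (k + c))⁻¹ = (k + c) * (Gamma (k + (c + 1)))⁻¹ := by
    rw [Gamma_inv_eq, add_assoc]
  have h4 : ((k + 1 : ℕ) : ℂ) + c = k + (c + 1) := by push_cast; ring
  have hf : (k.factorial : ℂ) ≠ 0 := by exact_mod_cast k.factorial_ne_zero
  have hk : (k : ℂ) + 1 ≠ 0 := by exact_mod_cast k.succ_ne_zero
  simp only [gaussTerm, div_eq_mul_inv, mul_inv, h1, h2, h4, h3, Nat.factorial_succ]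
  push_cast
  field_simp
  ring

theorem norm_Gamma_ratio_le {c : ℂ} (hc : 0 < c.re) (n k : ℕ) :
    ‖Gamma (n + c) / Gamma (k + (n + c))‖ ≤ ‖Gamma c / Gamma (k + c)‖ := by
  have hre (m : ℕ) : 0 < ((m : ℂ) + c).re := by
    simp; positivity
  induction k with
  | zero =>
    simp [div_self (Gamma_ne_zero_of_re_pos hc), div_self (Gamma_ne_zero_of_re_pos (hre n))]
  | succ k ih =>
    have e1 : ((k + 1 : ℕ) : ℂ) + (n + c) = (k + (n + c)) + 1 := by push_cast; ring
    have e2 : ((k + 1 : ℕ) : ℂ) + c = (k + c) + 1 := by push_cast; ring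
    have hre' : 0 < ((k : ℂ) + (n + c)).re := by simp; positivity
    have n1 : (k : ℂ) + c ≠ 0 := fun h => by simpa [h] using hre k
    have n2 : (k : ℂ) + (n + c) ≠ 0 := fun h => by simp [h] at hre'
    rw [e1, e2, Gamma_add_one _ n1, Gamma_add_one _ n2, mul_comm, mul_comm (k + c),
      ← div_div, ← div_div, norm_div, norm_div _ (_ + c)]
    gcongr
    rw [Complex.norm_def, Complex.norm_def]
    apply Real.sqrt_le_sqrt
    simp only [normSq_apply, add_re, natCast_re, add_im, natCast_im]
    have : (0:ℝ) ≤ n := n.cast_nonneg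
    have : (0:ℝ) ≤ k := k.cast_nonneg
    nlinarith

theorem gaussTerm_mul_Gamma_tendsto {a b c : ℂ} (h : 0 < (c - a - b).re) :
    Tendsto (fun n : ℕ => (∑' k, gaussTerm a b (c + n) k) * Gamma (n + c)) atTop
      (𝓝 (Gamma a * Gamma b)) := by
  obtain ⟨N, hN⟩ := exists_nat_gt (-c.re)
  have hNc : 0 < ((N : ℂ) + c).re := by simp; linarith
  have hsum : Summable fun k => ‖Gamma (N + c) * gaussTerm a b (N + c) k‖ := by
    simp_rw [norm_mul]
    apply (gaussTerm_summable_norm _).mul_left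
    simp at h ⊢
    have : (0:ℝ) ≤ N := N.cast_nonneg
    linarith
  have key := tendsto_tsum_of_dominated_convergence (𝓕 := atTop)
    (f := fun (n : ℕ) k => Gamma (n + c) * gaussTerm a b (c + n) k)
    (g := fun k => if k = 0 then Gamma a * Gamma b else 0) hsum ?_ ?_
  · rw [tsum_ite_eq] at key
    refine key.congr fun n => ?_
    rw [tsum_mul_left, mul_comm]
  · intro k
    have hlim : Tendsto (fun n : ℕ => Gamma (n + c) / Gamma (n + (k + c))) atTop
        (𝓝 (if k = 0 then 1 else 0)) := by
      split_ifs with hk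
      · subst hk
        simpa using tendsto_Gamma_ratio c c
      · refine tendsto_zero_of_cpow (p := (k + c) - c) ?_ (tendsto_Gamma_ratio c (k + c))
        simp; positivity
    have := hlim.const_mul (Gamma (k + a) * Gamma (k + b) / k.factorial)
    convert this using 2 with n
    · rw [gaussTerm, show (n : ℂ) + (k + c) = k + (c + n) by ring]; ring
    · split_ifs with hk <;> simp [hk]
  · filter_upwards [eventually_ge_atTop N] with n hn k
    obtain ⟨m, rfl⟩ := Nat.exists_eq_add_of_le hn
    have hb := norm_Gamma_ratio_le hNc m k
    have e : gaussTerm a b (c + (N + m : ℕ)) k * Gamma ((N + m : ℕ) + c) =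
        Gamma (k + a) * Gamma (k + b) / k.factorial *
          (Gamma (m + (N + c)) / Gamma (k + (m + (N + c)))) := by
      rw [gaussTerm]; push_cast
      rw [show (m : ℂ) + (N + c) = N + m + c by ring, show c + (N + m : ℂ) = N + m + c by ring]
      ring
    have e' : gaussTerm a b (N + c) k * Gamma (N + c) =
        Gamma (k + a) * Gamma (k + b) / k.factorial * (Gamma (N + c) / Gamma (k + (N + c))) := by
      rw [gaussTerm]; ring
    rw [mul_comm, e, mul_comm (Gamma _) (gaussTerm _ _ _ _), e', norm_mul, norm_mul]
    gcongr

theorem gauss_sum {a b c : ℂ} (ha : ∀ n : ℤ, a ≠ n) (hb : ∀ n : ℤ, b ≠ n)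
    (h : 0 < (c - a - b).re) :
    ∑' k, gaussTerm a b c k =
      Gamma a * Gamma b * Gamma (c - a - b) / (Gamma (c - a) * Gamma (c - b)) := by
  have hre (n : ℕ) : 0 < (c + n - a - b).re := by
    have : (0:ℝ) ≤ n := n.cast_nonneg
    simp at h ⊢; linarith
  have hGa : Gamma a ≠ 0 := Gamma_ne_zero fun m => by simpa using ha (-m)
  have hGb : Gamma b ≠ 0 := Gamma_ne_zero fun m => by simpa using hb (-m)
  have := eq_of_recurrence (X := fun n => ∑' k, gaussTerm a b (c + n) k)
    (Y := fun n => Gamma a * Gamma b * Gamma (c + n - a - b) /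
      (Gamma (c + n - a) * Gamma (c + n - b)))
    (p := fun n => (c + n - a) * (c + n - b)) (q := fun n => c + n - a - b)
    (w := fun n => Gamma (n + c)) (mul_ne_zero hGa hGb)
    (fun n h0 => by simpa [h0] using hre n) ?_ ?_ (gaussTerm_mul_Gamma_tendsto h) ?_
  · simpa using this
  · intro n
    have s1 := gaussTerm_summable_norm (hre n)
    have s2 := gaussTerm_summable_norm (hre (n + 1))
    rw [← sub_eq_zero, ← tsum_mul_left, ← tsum_mul_left,
      ← Summable.tsum_sub (s2.of_norm.mul_left _) (s1.of_norm.mul_left _)]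
    have := tsum_eq_of_telescope (R := fun k => (k : ℂ) * gaussTerm a b (c + n) k) (l := 0)
      ((s2.of_norm.mul_left ((c + n - a) * (c + n - b))).sub
        (s1.of_norm.mul_left (c + n - a - b))) ?_ ?_
    · simpa using this
    · intro k
      rw [← gaussTerm_telescope ha hb]
      push_cast
      rw [add_assoc]
    · refine tendsto_zero_of_cpow (hre n) ?_ (l := 1)
      refine (gaussTerm_tendsto a b (c + n)).congr' ?_
      filter_upwards [eventually_gt_atTop 0] with k hk
      have hk' : (k : ℂ) ≠ 0 := by exact_mod_cast hk.ne'
      rw [show (1 - a + (c + n - b) : ℂ) = (c + n - a - b) + 1 by ring, cpow_add _ _ hk', cpow_one]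
      ring
  · intro n
    have hn0 : c + n - a - b ≠ 0 := fun h0 => by simpa [h0] using hre n
    simp only [div_eq_mul_inv, mul_inv]
    rw [Gamma_inv_eq (c + n - a), Gamma_inv_eq (c + n - b)]
    have e1 : c + (n + 1 : ℕ) - a - b = (c + n - a - b) + 1 := by push_cast; ring
    have e2 : c + (n + 1 : ℕ) - a = (c + n - a) + 1 := by push_cast; ring
    have e3 : c + (n + 1 : ℕ) - b = (c + n - b) + 1 := by push_cast; ring
    rw [e1, e2, e3, Gamma_add_one _ hn0]
    ring
  · have h1 := tendsto_rpow_cpow_mul (tendsto_Gamma_ratio (c - a - b) (c - a))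
      (tendsto_Gamma_ratio c (c - b))
    have h2 := h1.const_mul (Gamma a * Gamma b)
    simp only [mul_one] at h2
    refine h2.congr fun n => ?_
    rw [show c - a - (c - a - b) + (c - b - c) = 0 by ring, cpow_zero,
      show c + n - a - b = n + (c - a - b) by ring, show c + n - a = n + (c - a) by ring,
      show c + n - b = n + (c - b) by ring]
    ring

def expPi (x : ℂ) : ℂ := exp (Real.pi * x * I)

theorem expPi_add (x y : ℂ) : expPi (x + y) = expPi x * expPi y := by
  rw [expPi, expPi, expPi, ← exp_add]; ring_nf

theorem expPi_neg (x : ℂ) : expPi (-x) = (expPi x)⁻¹ := by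
  rw [expPi, expPi, ← exp_neg]; ring_nf

theorem expPi_sub (x y : ℂ) : expPi (x - y) = expPi x / expPi y := by
  rw [sub_eq_add_neg, expPi_add, expPi_neg, div_eq_mul_inv]

theorem expPi_ne_zero (x : ℂ) : expPi x ≠ 0 := exp_ne_zero _

theorem expPi_one : expPi 1 = -1 := by rw [expPi, mul_one, exp_pi_mul_I]

theorem Sn_eq_expPi (x : ℂ) : Sn x = ((expPi x)⁻¹ - expPi x) * (I / 2) := by
  rw [Sn, Complex.sin, expPi, ← exp_neg, neg_mul]; ring

theorem Sn_neg (x : ℂ) : Sn (-x) = -Sn x := by rw [Sn, Sn, mul_neg, Complex.sin_neg]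

theorem Sn_sub_comm (x y : ℂ) : Sn (x - y) = -Sn (y - x) := by rw [← Sn_neg, neg_sub]

theorem Sn_add_one (x : ℂ) : Sn (x + 1) = -Sn x := by
  rw [Sn, Sn, mul_add, mul_one, Complex.sin_add_pi]

theorem Sn_one_sub (x : ℂ) : Sn (1 - x) = Sn x := by
  rw [Sn, Sn, mul_sub, mul_one, Complex.sin_pi_sub]

theorem Sn_ne_zero {x : ℂ} (hx : ∀ n : ℤ, x ≠ n) : Sn x ≠ 0 := by
  rw [Sn, Complex.sin_ne_zero_iff]
  intro k h
  apply hx k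
  have : (Real.pi : ℂ) ≠ 0 := by exact_mod_cast Real.pi_ne_zero
  apply mul_left_cancel₀ this
  rw [h]; ring

theorem pi_ne_zero' : (Real.pi : ℂ) ≠ 0 := by exact_mod_cast Real.pi_ne_zero

theorem Gamma_ne_zero' {x : ℂ} (hx : ∀ n : ℤ, x ≠ n) : Gamma x ≠ 0 :=
  Gamma_ne_zero fun m => by simpa using hx (-m)

theorem Gamma_mul_Gamma_one_sub' (x : ℂ) : Gamma x * Gamma (1 - x) = Real.pi / Sn x :=
  Gamma_mul_Gamma_one_sub x

theorem not_int_one_sub {x : ℂ} (hx : ∀ n : ℤ, x ≠ n) : ∀ n : ℤ, 1 - x ≠ n := fun n h =>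
  hx (1 - n) (by push_cast; linear_combination -h)

theorem not_int_neg {x : ℂ} (hx : ∀ n : ℤ, x ≠ n) : ∀ n : ℤ, -x ≠ n := fun n h =>
  hx (-n) (by push_cast; linear_combination -h)

theorem not_int_add {x : ℂ} (hx : ∀ n : ℤ, x ≠ n) (m : ℤ) : ∀ n : ℤ, x + m ≠ n := fun n h =>
  hx (n - m) (by push_cast; linear_combination h)

theorem not_int_of_re {x : ℂ} (h0 : 0 < x.re) (h1 : x.re < 1) : ∀ n : ℤ, x ≠ n := by
  rintro n rfl
  simp only [intCast_re] at h0 h1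
  have h0 : 0 < n := by exact_mod_cast h0
  have h1 : n < 1 := by exact_mod_cast h1
  omega

theorem inv_Gamma_one_sub {x : ℂ} (hx : ∀ n : ℤ, x ≠ n) :
    (Gamma (1 - x))⁻¹ = Gamma x * Sn x / Real.pi := by
  have h := Gamma_mul_Gamma_one_sub' x
  have h1 := Sn_ne_zero hx
  have h2 := Gamma_ne_zero' (not_int_one_sub hx)
  have h3 := pi_ne_zero'
  field_simp at h ⊢
  linear_combination -h

theorem barnes_trig (a b x y : ℂ) :
    Sn (a + y) * Sn (b + y) - Sn (a + x) * Sn (b + x) = Sn (a + b + x + y) * Sn (y - x) := by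
  simp only [Sn_eq_expPi, expPi_add, expPi_sub]
  have := expPi_ne_zero a
  have := expPi_ne_zero b
  have := expPi_ne_zero x
  have := expPi_ne_zero y
  field_simp
  ring

theorem barnes_first {a b x y : ℂ} (hax : ∀ n : ℤ, a + x ≠ n) (hay : ∀ n : ℤ, a + y ≠ n)
    (hbx : ∀ n : ℤ, b + x ≠ n) (hby : ∀ n : ℤ, b + y ≠ n) (hxy : ∀ n : ℤ, y - x ≠ n)
    (h0 : 0 < (a + b + x + y).re) (h1 : (a + b + x + y).re < 1) :
    Real.pi / Sn (y - x) * (∑' k, gaussTerm (a + x) (b + x) (1 + x - y) k -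
      ∑' k, gaussTerm (a + y) (b + y) (1 + y - x) k) =
    Gamma (a + x) * Gamma (a + y) * Gamma (b + x) * Gamma (b + y) / Gamma (a + b + x + y) := by
  rw [gauss_sum hax hbx (by simp at h1 ⊢; linarith), gauss_sum hay hby (by simp at h1 ⊢; linarith),
    show 1 + x - y - (a + x) = 1 - (a + y) by ring, show 1 + x - y - (b + x) = 1 - (b + y) by ring,
    show 1 + y - x - (a + y) = 1 - (a + x) by ring, show 1 + y - x - (b + y) = 1 - (b + x) by ring,
    show 1 - (a + y) - (b + x) = 1 - (a + b + x + y) by ring,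
    show 1 - (a + x) - (b + y) = 1 - (a + b + x + y) by ring]
  simp only [div_eq_mul_inv, mul_inv]
  have hγ : ∀ n : ℤ, a + b + x + y ≠ n := not_int_of_re h0 h1
  have e := Gamma_mul_Gamma_one_sub' (a + b + x + y)
  have g0 := Gamma_ne_zero' hγ
  have s0 := Sn_ne_zero hγ
  have s1 := Sn_ne_zero hxy
  have t := barnes_trig a b x y
  have p0 := pi_ne_zero'
  have e' : Gamma (1 - (a + b + x + y)) = Real.pi / Sn (a + b + x + y) / Gamma (a + b + x + y) := by
    field_simp at e ⊢
    linear_combination e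
  rw [inv_Gamma_one_sub hax, inv_Gamma_one_sub hay, inv_Gamma_one_sub hbx, inv_Gamma_one_sub hby, e']
  field_simp
  linear_combination Gamma (a + x) * Gamma (b + x) * Gamma (a + y) * Gamma (b + y) * t

def saalTerm (a b x y γ s : ℂ) (k : ℕ) : ℂ :=
  gaussTerm (a + x) (b + x) (1 + x - y) k * (Gamma (k + (s + x)) / Gamma (k + (s + γ + x)))

theorem saalTerm_isBigO (a b x y s : ℂ) :
    saalTerm a b x y (a + b + x + y) s =O[atTop] fun n : ℕ => (n : ℝ) ^ (-2 : ℝ) := by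
  have h := isBigO_rpow_mul (gaussTerm_isBigO (a + x) (b + x) (1 + x - y))
    (Gamma_ratio_isBigO (s + x) (s + (a + b + x + y) + x))
  have e : (a + x + (b + x) - (1 + x - y) - 1).re + (s + x - (s + (a + b + x + y) + x)).re
    = -2 := by simp; ring
  rwa [e] at h

theorem saalTerm_summable (a b x y s : ℂ) :
    Summable fun k => ‖saalTerm a b x y (a + b + x + y) s k‖ :=
  summable_norm_of_isBigO_rpow (by norm_num) (saalTerm_isBigO a b x y s)

theorem saalTerm_telescope {a b x y s : ℂ} (hax : ∀ n : ℤ, a + x ≠ n)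
    (hbx : ∀ n : ℤ, b + x ≠ n) (hsx : ∀ n : ℤ, s + x ≠ n) (k : ℕ) :
    (s + (a + b + x + y) - a) * (s + (a + b + x + y) - b) *
        saalTerm a b x y (a + b + x + y) (s + 1) k -
      (s + x) * (s + y) * saalTerm a b x y (a + b + x + y) s k =
    (k + 1 : ℕ) * ((k + 1 : ℕ) + x - y) * saalTerm a b x y (a + b + x + y) s (k + 1) -
      k * (k + x - y) * saalTerm a b x y (a + b + x + y) s k := by
  have h1 : Gamma ((k + 1 : ℕ) + (a + x)) = (k + (a + x)) * Gamma (k + (a + x)) := by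
    rw [← Gamma_add_one _ (ne_zero_of_add_nat hax k)]; congr 1; push_cast; ring
  have h2 : Gamma ((k + 1 : ℕ) + (b + x)) = (k + (b + x)) * Gamma (k + (b + x)) := by
    rw [← Gamma_add_one _ (ne_zero_of_add_nat hbx k)]; congr 1; push_cast; ring
  have h5 : Gamma (k + (s + 1 + x)) = (k + (s + x)) * Gamma (k + (s + x)) := by
    rw [← Gamma_add_one _ (ne_zero_of_add_nat hsx k)]; congr 1; ring
  have h5' : Gamma ((k + 1 : ℕ) + (s + x)) = (k + (s + x)) * Gamma (k + (s + x)) := by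
    rw [← Gamma_add_one _ (ne_zero_of_add_nat hsx k)]; congr 1; push_cast; ring
  have h3 : (Gamma (k + (1 + x - y)))⁻¹ =
      (k + (1 + x - y)) * (Gamma ((k + 1 : ℕ) + (1 + x - y)))⁻¹ := by
    rw [Gamma_inv_eq]; congr 3; push_cast; ring
  have h4 : (Gamma (k + (s + (a + b + x + y) + x)))⁻¹ =
      (k + (s + (a + b + x + y) + x)) * (Gamma (k + (s + 1 + (a + b + x + y) + x)))⁻¹ := by
    rw [Gamma_inv_eq]; congr 3; ring
  have h4' : ((k + 1 : ℕ) : ℂ) + (s + (a + b + x + y) + x) = k + (s + 1 + (a + b + x + y) + x) := by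
    push_cast; ring
  have hf : (k.factorial : ℂ) ≠ 0 := by exact_mod_cast k.factorial_ne_zero
  have hk : (k : ℂ) + 1 ≠ 0 := by exact_mod_cast k.succ_ne_zero
  simp only [saalTerm, gaussTerm, div_eq_mul_inv, mul_inv, h1, h2, h4', h3, h4, h5, h5',
    Nat.factorial_succ]
  push_cast
  field_simp
  ring

theorem saalTerm_sum_step {a b x y s : ℂ} (hax : ∀ n : ℤ, a + x ≠ n)
    (hbx : ∀ n : ℤ, b + x ≠ n) (hsx : ∀ n : ℤ, s + x ≠ n) :
    (s + (a + b + x + y) - a) * (s + (a + b + x + y) - b) *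
        ∑' k, saalTerm a b x y (a + b + x + y) (s + 1) k -
      (s + x) * (s + y) * ∑' k, saalTerm a b x y (a + b + x + y) s k = 1 := by
  have s1 := (saalTerm_summable a b x y s).of_norm
  have s2 := (saalTerm_summable a b x y (s + 1)).of_norm
  rw [← tsum_mul_left, ← tsum_mul_left, ← Summable.tsum_sub (s2.mul_left _) (s1.mul_left _)]
  have := tsum_eq_of_telescope
    (R := fun k => (k : ℂ) * (k + x - y) * saalTerm a b x y (a + b + x + y) s k) (l := 1)
    ((s2.mul_left _).sub (s1.mul_left _)) (fun k => saalTerm_telescope hax hbx hsx k) ?_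
  · simpa using this
  · have h1 := tendsto_rpow_cpow_mul (gaussTerm_tendsto (a + x) (b + x) (1 + x - y))
      (tendsto_Gamma_ratio (s + x) (s + (a + b + x + y) + x))
    have h2 : Tendsto (fun n : ℕ => ((n + (x - y)) / n : ℂ)) atTop (𝓝 1) := by
      have := (tendsto_natCast_div_add_atTop (𝕜 := ℂ) (x - y)).inv₀ one_ne_zero
      simpa using this
    have h3 := h1.mul h2
    simp only [mul_one] at h3
    refine h3.congr' ?_
    filter_upwards [eventually_gt_atTop 0] with n hn
    have hn' : (n : ℂ) ≠ 0 := by exact_mod_cast hn.ne'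
    rw [show 1 - (a + x) + (1 + x - y - (b + x)) + (s + (a + b + x + y) + x - (s + x)) =
      ((2 : ℕ) : ℂ) by push_cast; ring, cpow_natCast, saalTerm]
    field_simp
    ring

theorem saalTerm_sum_tendsto {a b x y : ℂ} (s : ℂ) (h0 : 0 < (a + b + x + y).re)
    (h1 : (a + b + x + y).re < 1) :
    Tendsto (fun n : ℕ => (∑' k, saalTerm a b x y (a + b + x + y) (s + n) k) *
      (n : ℂ) ^ (a + b + x + y)) atTop (𝓝 (∑' k, gaussTerm (a + x) (b + x) (1 + x - y) k)) := by
  set γ := a + b + x + y with hγ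
  have hlim (k : ℕ) := tendsto_Gamma_ratio (k + (s + x)) (k + (s + γ + x))
  obtain ⟨C, hC⟩ : ∃ C : ℝ, ∀ n : ℕ,
      ‖Gamma (n + (s + x)) / Gamma (n + (s + γ + x)) * (n : ℂ) ^ γ‖ ≤ C := by
    have h := tendsto_Gamma_ratio (s + x) (s + γ + x)
    rw [show s + γ + x - (s + x) = γ by ring] at h
    obtain ⟨C, hC⟩ := h.norm.bddAbove_range
    exact ⟨C, fun n => hC ⟨n, rfl⟩⟩
  have hsum : Summable fun k => ‖gaussTerm (a + x) (b + x) (1 + x - y) k‖ * C :=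
    (gaussTerm_summable_norm (by simp [hγ] at h1 ⊢; linarith)).mul_right _
  have key := tendsto_tsum_of_dominated_convergence (𝓕 := atTop)
    (f := fun (n : ℕ) k => saalTerm a b x y γ (s + n) k * (n : ℂ) ^ γ)
    (g := fun k => gaussTerm (a + x) (b + x) (1 + x - y) k) hsum ?_ ?_
  · simpa only [tsum_mul_right] using key
  · intro k
    have := (hlim k).const_mul (gaussTerm (a + x) (b + x) (1 + x - y) k)
    rw [mul_one, show k + (s + γ + x) - (k + (s + x)) = γ by ring] at this
    refine this.congr fun n => ?_
    rw [saalTerm, ← mul_assoc, show (n : ℂ) + (k + (s + x)) = k + (s + n + x) by ring,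
      show (n : ℂ) + (k + (s + γ + x)) = k + (s + n + γ + x) by ring]
  · filter_upwards [eventually_gt_atTop 0] with n hn k
    rw [saalTerm, mul_assoc, norm_mul]
    gcongr
    refine le_trans ?_ (hC (n + k))
    rw [norm_mul, norm_mul, norm_natCast_cpow_of_pos hn, norm_natCast_cpow_of_pos (by omega)]
    push_cast
    rw [show (k : ℂ) + (s + n + x) = n + k + (s + x) by ring,
      show (k : ℂ) + (s + n + γ + x) = n + k + (s + γ + x) by ring]
    gcongr
    simp

/-- The non-terminating form of Saalschütz's theorem. -/
theorem saalschutz {a b x y s : ℂ} (hax : ∀ n : ℤ, a + x ≠ n) (hay : ∀ n : ℤ, a + y ≠ n)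
    (hbx : ∀ n : ℤ, b + x ≠ n) (hby : ∀ n : ℤ, b + y ≠ n) (hxy : ∀ n : ℤ, y - x ≠ n)
    (hsx : ∀ n : ℤ, s + x ≠ n) (hsy : ∀ n : ℤ, s + y ≠ n)
    (h0 : 0 < (a + b + x + y).re) (h1 : (a + b + x + y).re < 1) :
    Real.pi / Sn (y - x) * (∑' k, saalTerm a b x y (a + b + x + y) s k -
      ∑' k, saalTerm a b y x (a + b + x + y) s k) =
    Gamma (a + x) * Gamma (a + y) * Gamma (b + x) * Gamma (b + y) / Gamma (a + b + x + y) *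
      (Gamma (s + x) * Gamma (s + y) / (Gamma (s + (a + b + x + y) - a) *
        Gamma (s + (a + b + x + y) - b))) := by
  have hsn {z : ℂ} (hz : ∀ n : ℤ, s + z ≠ n) (n : ℕ) : ∀ m : ℤ, s + n + z ≠ m := by
    have := not_int_add hz n
    intro m
    rw [add_right_comm]
    exact_mod_cast this m
  have hγ : ∀ n : ℤ, a + b + x + y ≠ n := not_int_of_re h0 h1
  have e : a + b + y + x = a + b + x + y := by ring
  have := eq_of_recurrence
    (X := fun n => Real.pi / Sn (y - x) * (∑' k, saalTerm a b x y (a + b + x + y) (s + n) k -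
      ∑' k, saalTerm a b y x (a + b + x + y) (s + n) k))
    (Y := fun n => Gamma (a + x) * Gamma (a + y) * Gamma (b + x) * Gamma (b + y) /
      Gamma (a + b + x + y) * (Gamma (s + n + x) * Gamma (s + n + y) /
        (Gamma (s + n + (a + b + x + y) - a) * Gamma (s + n + (a + b + x + y) - b))))
    (p := fun n => (s + n + (a + b + x + y) - a) * (s + n + (a + b + x + y) - b))
    (q := fun n => (s + n + x) * (s + n + y))
    (w := fun n => (n : ℂ) ^ (a + b + x + y))
    (l := Gamma (a + x) * Gamma (a + y) * Gamma (b + x) * Gamma (b + y) / Gamma (a + b + x + y))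
    ?_ ?_ ?_ ?_ ?_ ?_
  · simpa using this
  · exact div_ne_zero (mul_ne_zero (mul_ne_zero (mul_ne_zero (Gamma_ne_zero' hax)
      (Gamma_ne_zero' hay)) (Gamma_ne_zero' hbx)) (Gamma_ne_zero' hby)) (Gamma_ne_zero' hγ)
  · intro n
    exact mul_ne_zero (by simpa using hsn hsx n 0) (by simpa using hsn hsy n 0)
  · intro n
    have e1 := saalTerm_sum_step (y := y) hax hbx (hsn hsx n)
    have e2 := saalTerm_sum_step (y := x) hay hby (hsn hsy n)
    rw [e] at e2
    have e0 : s + ((n + 1 : ℕ) : ℂ) = s + n + 1 := by push_cast; ring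
    simp only [e0]
    linear_combination (Real.pi / Sn (y - x)) * (e1 - e2)
  · intro n
    simp only [div_eq_mul_inv, mul_inv]
    rw [Gamma_inv_eq (s + n + (a + b + x + y) - a), Gamma_inv_eq (s + n + (a + b + x + y) - b)]
    have e1 : s + (n + 1 : ℕ) + (a + b + x + y) - a = s + n + (a + b + x + y) - a + 1 := by
      push_cast; ring
    have e2 : s + (n + 1 : ℕ) + (a + b + x + y) - b = s + n + (a + b + x + y) - b + 1 := by
      push_cast; ring
    have e3 : s + (n + 1 : ℕ) + x = s + n + x + 1 := by push_cast; ring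
    have e4 : s + (n + 1 : ℕ) + y = s + n + y + 1 := by push_cast; ring
    rw [e1, e2, e3, e4, Gamma_add_one _ (by simpa using hsn hsx n 0),
      Gamma_add_one _ (by simpa using hsn hsy n 0)]
    ring
  · have t1 := saalTerm_sum_tendsto s h0 h1
    have t2 := saalTerm_sum_tendsto (a := a) (b := b) (x := y) (y := x) s
      (by rwa [e]) (by rwa [e])
    rw [e] at t2
    have t3 := (t1.sub t2).const_mul (Real.pi / Sn (y - x))
    rw [barnes_first hax hay hbx hby hxy h0 h1] at t3
    refine t3.congr fun n => ?_
    ring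
  · have h1 := tendsto_rpow_cpow_mul (tendsto_Gamma_ratio (s + x) (s + (a + b + x + y) - a))
      (tendsto_Gamma_ratio (s + y) (s + (a + b + x + y) - b))
    have h2 := h1.const_mul (Gamma (a + x) * Gamma (a + y) * Gamma (b + x) * Gamma (b + y) /
      Gamma (a + b + x + y))
    simp only [mul_one] at h2
    refine h2.congr fun n => ?_
    rw [show s + (a + b + x + y) - a - (s + x) + (s + (a + b + x + y) - b - (s + y)) =
      a + b + x + y by ring,
      show s + n + x = n + (s + x) by ring, show s + n + y = n + (s + y) by ring,
      show s + n + (a + b + x + y) - a = n + (s + (a + b + x + y) - a) by ring,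
      show s + n + (a + b + x + y) - b = n + (s + (a + b + x + y) - b) by ring]
    ring

theorem Fstar_swap₁₂ (a b c d e f g : ℂ) : Fstar a b c d e f g = Fstar b a c d e f g := by
  simp only [Fstar]; congr 1; ext k; ring

theorem Fstar_swap₂₃ (a b c d e f g : ℂ) : Fstar a b c d e f g = Fstar a c b d e f g := by
  simp only [Fstar]; congr 1; ext k; ring

theorem Fstar_swap₃₄ (a b c d e f g : ℂ) : Fstar a b c d e f g = Fstar a b d c e f g := by
  simp only [Fstar]; congr 1; ext k; ring

theorem Fstar_swap₅₆ (a b c d e f g : ℂ) : Fstar a b c d e f g = Fstar a b c d f e g := by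
  simp only [Fstar]; congr 1; ext k; ring

theorem Fstar_swap₆₇ (a b c d e f g : ℂ) : Fstar a b c d e f g = Fstar a b c d e g f := by
  simp only [Fstar]; congr 1; ext k; ring

def doubleTerm (γ a b x y p q c d : ℂ) (k j : ℕ) : ℂ :=
  gaussTerm (a + x) (b + x) (1 + x - y) k * gaussTerm (p + c) (q + c) (1 + c - d) j *
    (Gamma (k + j + (x + c)) / Gamma (k + j + (x + c + γ)))

def doubleSum (γ a b x y p q c d : ℂ) : ℂ :=
  ∑' k, ∑' j, doubleTerm γ a b x y p q c d k j

theorem doubleTerm_summable {γ a b x y p q c d : ℂ} (h0 : 0 < γ.re) (h1 : γ.re < 1)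
    (hab : a + b + x + y = γ) (hpq : p + q + c + d = γ) :
    Summable (Function.uncurry (doubleTerm γ a b x y p q c d)) := by
  subst hab
  have s1 : Summable fun k => ‖gaussTerm (a + x) (b + x) (1 + x - y) k‖ :=
    gaussTerm_summable_norm (by simp at h1 ⊢; linarith)
  have s2 : Summable fun k => ‖gaussTerm (p + c) (q + c) (1 + c - d) k‖ :=
    gaussTerm_summable_norm (by rw [← hpq] at h1; simp at h1 ⊢; linarith)
  have hlim : Tendsto (fun n : ℕ => Gamma (n + (x + c)) / Gamma (n + (x + c + (a + b + x + y))))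
      atTop (𝓝 0) :=
    tendsto_zero_of_cpow (by simpa using h0) (tendsto_Gamma_ratio (x + c) (x + c + (a + b + x + y)))
  obtain ⟨C, hC⟩ := hlim.norm.bddAbove_range
  have hC' (n : ℕ) := hC ⟨n, rfl⟩
  refine Summable.of_norm_bounded ((s1.mul_of_nonneg s2 (fun _ => norm_nonneg _)
    (fun _ => norm_nonneg _)).mul_right C) ?_
  rintro ⟨k, j⟩
  simp only [Function.uncurry, doubleTerm, norm_mul]
  have := hC' (k + j)
  push_cast at this
  gcongr

theorem doubleSum_comm {γ a b x y p q c d : ℂ} (h0 : 0 < γ.re) (h1 : γ.re < 1)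
    (hab : a + b + x + y = γ) (hpq : p + q + c + d = γ) :
    doubleSum γ a b x y p q c d = doubleSum γ p q c d a b x y := by
  rw [doubleSum, doubleSum]
  refine (Summable.tsum_comm (f := doubleTerm γ a b x y p q c d)
    (doubleTerm_summable h0 h1 hab hpq)).symm.trans ?_
  congr 1; ext k; congr 1; ext j
  simp only [doubleTerm]
  rw [show (j : ℂ) + k + (x + c) = k + j + (c + x) by ring,
    show (j : ℂ) + k + (x + c + γ) = k + j + (c + x + γ) by ring]
  ring

theorem Fstar_mul_eq_doubleSum {γ a b x y p q c d : ℂ} (h0 : 0 < γ.re) (h1 : γ.re < 1)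
    (hab : a + b + x + y = γ) (hpq : p + q + c + d = γ)
    (hpc : ∀ n : ℤ, p + c ≠ n) (hpd : ∀ n : ℤ, p + d ≠ n)
    (hqc : ∀ n : ℤ, q + c ≠ n) (hqd : ∀ n : ℤ, q + d ≠ n) (hcd : ∀ n : ℤ, d - c ≠ n)
    (hxc : ∀ n : ℤ, x + c ≠ n) (hxd : ∀ n : ℤ, x + d ≠ n) :
    Fstar (a + x) (b + x) (c + x) (d + x) (1 + x - y) (γ - p + x) (γ - q + x) *
      (Gamma (p + c) * Gamma (p + d) * Gamma (q + c) * Gamma (q + d)) =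
    Gamma γ * (Real.pi / Sn (d - c)) *
      (doubleSum γ a b x y p q c d - doubleSum γ a b x y p q d c) := by
  have hpq' : p + q + d + c = γ := by rw [← hpq]; ring
  have S1 := doubleTerm_summable h0 h1 hab hpq
  have S2 := doubleTerm_summable h0 h1 hab hpq'
  rw [doubleSum, doubleSum, ← Summable.tsum_sub (f := fun k => ∑' j, doubleTerm γ a b x y p q c d k j)
      (g := fun k => ∑' j, doubleTerm γ a b x y p q d c k j) S1.prod S2.prod, ← tsum_mul_left, Fstar,
    ← tsum_mul_right]
  congr 1; ext k
  have hs {z : ℂ} (hz : ∀ n : ℤ, x + z ≠ n) : ∀ m : ℤ, (x + k) + z ≠ m := by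
    have := not_int_add hz k
    intro m
    rw [add_right_comm]
    exact_mod_cast this m
  have key := saalschutz (s := x + k) hpc hpd hqc hqd hcd (hs hxc) (hs hxd)
    (by rwa [hpq]) (by rwa [hpq])
  rw [hpq] at key
  have hγ : Gamma γ ≠ 0 := Gamma_ne_zero_of_re_pos h0
  have e1 : ∑' j, doubleTerm γ a b x y p q c d k j =
      gaussTerm (a + x) (b + x) (1 + x - y) k * ∑' j, saalTerm p q c d γ (x + k) j := by
    rw [← tsum_mul_left]; congr 1; ext j
    rw [doubleTerm, saalTerm, show (j : ℂ) + (x + k + c) = k + j + (x + c) by ring,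
      show (j : ℂ) + (x + k + γ + c) = k + j + (x + c + γ) by ring]
    ring
  have e2 : ∑' j, doubleTerm γ a b x y p q d c k j =
      gaussTerm (a + x) (b + x) (1 + x - y) k * ∑' j, saalTerm p q d c γ (x + k) j := by
    rw [← tsum_mul_left]; congr 1; ext j
    rw [doubleTerm, saalTerm, show (j : ℂ) + (x + k + d) = k + j + (x + d) by ring,
      show (j : ℂ) + (x + k + γ + d) = k + j + (x + d + γ) by ring]
    ring
  rw [e1, e2, ← mul_sub]
  calc _ = Gamma γ * gaussTerm (a + x) (b + x) (1 + x - y) k *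
        (Gamma (p + c) * Gamma (p + d) * Gamma (q + c) * Gamma (q + d) / Gamma γ *
          (Gamma (x + k + c) * Gamma (x + k + d) / (Gamma (x + k + γ - p) *
            Gamma (x + k + γ - q)))) := by
        rw [gaussTerm, show (k : ℂ) + (c + x) = x + k + c by ring,
          show (k : ℂ) + (d + x) = x + k + d by ring,
          show (k : ℂ) + (γ - p + x) = x + k + γ - p by ring,
          show (k : ℂ) + (γ - q + x) = x + k + γ - q by ring]
        have aux (G X Y Z : ℂ) (hG : G ≠ 0) : G * X * (Y / G * Z) = X * Y * Z := by field_simp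
        rw [aux _ _ _ _ hγ]
        simp only [div_eq_mul_inv, mul_inv]
        ring
    _ = _ := by rw [← key]; ring

def Pf (a b c d x y f g : ℂ) : ℂ :=
  Real.pi / Sn (y - x) * (Fstar (a + x) (b + x) (c + x) (d + x) (1 + x - y) (f + x) (g + x) -
    Fstar (a + y) (b + y) (c + y) (d + y) (1 + y - x) (f + y) (g + y))

theorem Pf_mul_eq {γ a b x y p q c d : ℂ} (h0 : 0 < γ.re) (h1 : γ.re < 1)
    (hab : a + b + x + y = γ) (hpq : p + q + c + d = γ)
    (hpc : ∀ n : ℤ, p + c ≠ n) (hpd : ∀ n : ℤ, p + d ≠ n)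
    (hqc : ∀ n : ℤ, q + c ≠ n) (hqd : ∀ n : ℤ, q + d ≠ n)
    (hcd : ∀ n : ℤ, d - c ≠ n) (hxc : ∀ n : ℤ, x + c ≠ n) (hxd : ∀ n : ℤ, x + d ≠ n)
    (hyc : ∀ n : ℤ, y + c ≠ n) (hyd : ∀ n : ℤ, y + d ≠ n) :
    Pf a b c d x y (γ - p) (γ - q) *
      (Gamma (p + c) * Gamma (p + d) * Gamma (q + c) * Gamma (q + d)) =
    Gamma γ * (Real.pi / Sn (y - x)) * (Real.pi / Sn (d - c)) *
      (doubleSum γ a b x y p q c d - doubleSum γ a b x y p q d c -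
        doubleSum γ a b y x p q c d + doubleSum γ a b y x p q d c) := by
  have k1 := Fstar_mul_eq_doubleSum h0 h1 hab hpq hpc hpd hqc hqd hcd hxc hxd
  have k2 := Fstar_mul_eq_doubleSum (a := a) (b := b) (x := y) (y := x) h0 h1 (by rw [← hab]; ring) hpq
    hpc hpd hqc hqd hcd hyc hyd
  rw [Pf]
  linear_combination (Real.pi / Sn (y - x)) * (k1 - k2)

/-- One step of the chain of two-term relations. -/
theorem Pf_step (a b c d x y f g p q a' b' : ℂ) {u₁ u₂ u₃ u₄ v₁ v₂ v₃ v₄ w₁ w₂ w₃ w₄ z t γ : ℂ}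
    (h0 : 0 < γ.re) (h1 : γ.re < 1) (hγ : a + b + x + y = γ)
    (hf : f = γ - p) (hg : g = γ - q) (ha' : a' = γ - a) (hb' : b' = γ - b)
    (hpq : p + q + c + d = γ)
    (hu₁ : p + c = u₁) (hu₂ : p + d = u₂) (hu₃ : q + c = u₃) (hu₄ : q + d = u₄)
    (hv₁ : a + x = v₁) (hv₂ : a + y = v₂) (hv₃ : b + x = v₃) (hv₄ : b + y = v₄)
    (hw₁ : c + x = w₁) (hw₂ : c + y = w₂) (hw₃ : d + x = w₃) (hw₄ : d + y = w₄)
    (hz : d - c = z) (ht : y - x = t)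
    (hpc : ∀ n : ℤ, u₁ ≠ n) (hpd : ∀ n : ℤ, u₂ ≠ n)
    (hqc : ∀ n : ℤ, u₃ ≠ n) (hqd : ∀ n : ℤ, u₄ ≠ n)
    (hax : ∀ n : ℤ, v₁ ≠ n) (hay : ∀ n : ℤ, v₂ ≠ n)
    (hbx : ∀ n : ℤ, v₃ ≠ n) (hby : ∀ n : ℤ, v₄ ≠ n)
    (hcx : ∀ n : ℤ, w₁ ≠ n) (hcy : ∀ n : ℤ, w₂ ≠ n)
    (hdx : ∀ n : ℤ, w₃ ≠ n) (hdy : ∀ n : ℤ, w₄ ≠ n)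
    (hcd : ∀ n : ℤ, z ≠ n) (hxy : ∀ n : ℤ, t ≠ n) :
    Pf a b c d x y f g * (Gamma u₁ * Gamma u₂ * Gamma u₃ * Gamma u₄) =
    Pf p q x y c d a' b' * (Gamma v₁ * Gamma v₂ * Gamma v₃ * Gamma v₄) := by
  subst hu₁ hu₂ hu₃ hu₄ hv₁ hv₂ hv₃ hv₄ hw₁ hw₂ hw₃ hw₄ hz ht hf hg ha' hb'
  rw [Pf_mul_eq h0 h1 hγ hpq hpc hpd hqc hqd hcd
      (fun n => by rw [add_comm]; exact hcx n) (fun n => by rw [add_comm]; exact hdx n)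
      (fun n => by rw [add_comm]; exact hcy n) (fun n => by rw [add_comm]; exact hdy n),
    Pf_mul_eq h0 h1 hpq hγ hax hay hbx hby hxy hcx hcy hdx hdy]
  have hγ' : a + b + y + x = γ := by rw [← hγ]; ring
  have hpq' : p + q + d + c = γ := by rw [← hpq]; ring
  rw [doubleSum_comm h0 h1 hγ hpq, doubleSum_comm h0 h1 hγ hpq', doubleSum_comm h0 h1 hγ' hpq,
    doubleSum_comm h0 h1 hγ' hpq']
  ring

/-- A two-term relation for the difference of two Saalschützian series. -/
theorem Fstar_two_term {A B C D E F G : ℂ} (hs : E + F + G = A + B + C + D + 1)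
    (hA : ∀ n : ℤ, A ≠ n) (hB : ∀ n : ℤ, B ≠ n) (hC : ∀ n : ℤ, C ≠ n) (hD : ∀ n : ℤ, D ≠ n)
    (hAE : ∀ n : ℤ, 1 + A - E ≠ n) (hBE : ∀ n : ℤ, 1 + B - E ≠ n)
    (hCE : ∀ n : ℤ, 1 + C - E ≠ n) (hDE : ∀ n : ℤ, 1 + D - E ≠ n)
    (hAF : ∀ n : ℤ, F - A ≠ n) (hBF : ∀ n : ℤ, F - B ≠ n)
    (hCF : ∀ n : ℤ, F - C ≠ n) (hDF : ∀ n : ℤ, F - D ≠ n)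
    (hAG : ∀ n : ℤ, G - A ≠ n) (hBG : ∀ n : ℤ, G - B ≠ n)
    (hCG : ∀ n : ℤ, G - C ≠ n) (hDG : ∀ n : ℤ, G - D ≠ n)
    (hE : ∀ n : ℤ, E ≠ n) (hCD : ∀ n : ℤ, D - C ≠ n) (hAB : ∀ n : ℤ, B - A ≠ n)
    (hFAB : ∀ n : ℤ, A + B - F ≠ n) (hFG : ∀ n : ℤ, F - G ≠ n)
    (w0 : 0 < (1 + A + B - E).re) (w1 : (1 + A + B - E).re < 1)
    (w2 : 0 < F.re) (w3 : F.re < 1) (w4 : 0 < (1 + G - E).re) (w5 : (1 + G - E).re < 1) :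
    (Fstar A B C D E F G -
      Fstar (1 + A - E) (1 + B - E) (1 + C - E) (1 + D - E) (2 - E) (1 + F - E) (1 + G - E)) /
      Sn E * (Gamma (F - A) * Gamma (F - B) * Gamma (F - C) * Gamma (F - D) *
        (Gamma (G - A) * Gamma (G - B) * Gamma (G - C) * Gamma (G - D))) =
    (Fstar (G - A) (G - B) (G - C) (G - D) (1 + G - F) (1 + G - E) G -
      Fstar (F - A) (F - B) (F - C) (F - D) (1 + F - G) (1 + F - E) F) / Sn (F - G) *
      (Gamma A * Gamma B * Gamma C * Gamma D *
        (Gamma (1 + A - E) * Gamma (1 + B - E) * Gamma (1 + C - E) * Gamma (1 + D - E))) := by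
  obtain ⟨γ, hγ⟩ : ∃ γ, 1 + A + B - E = γ := ⟨_, rfl⟩
  rw [hγ] at w0 w1
  have hE' : ∀ n : ℤ, 1 - E ≠ n := not_int_one_sub hE
  have st1 := Pf_step A B C D 0 (1 - E) F G (γ - F) (γ - G) (1 + B - E) (1 + A - E)
    (u₁ := G - D) (u₂ := G - C) (u₃ := F - D) (u₄ := F - C)
    (v₁ := A) (v₂ := 1 + A - E) (v₃ := B) (v₄ := 1 + B - E)
    (w₁ := C) (w₂ := 1 + C - E) (w₃ := D) (w₄ := 1 + D - E) (z := D - C) (t := 1 - E) w0 w1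
    (by linear_combination hγ) (by ring) (by ring) (by linear_combination hγ)
    (by linear_combination hγ) (by linear_combination -hγ - hs)
    (by linear_combination -hγ - hs) (by linear_combination -hγ - hs)
    (by linear_combination -hγ - hs) (by linear_combination -hγ - hs)
    (by ring) (by ring) (by ring) (by ring) (by ring) (by ring) (by ring) (by ring)
    (by ring) (by ring) hDG hCG hDF hCF hA hAE hB hBE hC hCE hD hDE hCD hE'
  have p1 : Pf (γ - F) (γ - G) 0 (1 - E) C D (1 + B - E) (1 + A - E) =
      Pf 0 (γ - G) (1 - E) (γ - F) C D (1 + B - E) (1 + A - E) := by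
    simp only [Pf]
    congr 2 <;> rw [Fstar_swap₂₃, Fstar_swap₁₂, Fstar_swap₂₃, Fstar_swap₃₄]
  have st2 := Pf_step 0 (γ - G) (1 - E) (γ - F) C D (1 + B - E) (1 + A - E)
    (F - 1 - B + E) (F - 1 - A + E) F (F - γ + G)
    (u₁ := F - B) (u₂ := A) (u₃ := F - A) (u₄ := B)
    (v₁ := C) (v₂ := D) (v₃ := F - D) (v₄ := F - C)
    (w₁ := 1 + C - E) (w₂ := 1 + D - E) (w₃ := G - D) (w₄ := G - C)
    (z := A + B - F) (t := D - C) w2 w3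
    (by linear_combination -hγ - hs) (by ring) (by ring) (by ring)
    (by ring) (by linear_combination -hγ)
    (by ring) (by linear_combination -hγ)
    (by ring) (by linear_combination -hγ)
    (by ring) (by ring) (by linear_combination -hγ - hs) (by linear_combination -hγ - hs)
    (by ring) (by ring) (by linear_combination -hγ - hs) (by linear_combination -hγ - hs)
    (by linear_combination -hγ) (by ring) hBF hA hAF hB hC hD hDF hCF hCE hDE hDG hCG hFAB hCD
  have p2 : Pf (F - 1 - B + E) (F - 1 - A + E) C D (1 - E) (γ - F) F (F - γ + G) =
      Pf C D (F - 1 - B + E) (F - 1 - A + E) (1 - E) (γ - F) F (F - γ + G) := by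
    simp only [Pf]
    congr 2 <;> rw [Fstar_swap₂₃, Fstar_swap₁₂, Fstar_swap₃₄, Fstar_swap₂₃]
  have st3 := Pf_step C D (F - 1 - B + E) (F - 1 - A + E) (1 - E) (γ - F) F (F - γ + G)
    (1 + G - E - F) (1 - E - F + γ) (1 + G - E - C) (1 + G - E - D)
    (u₁ := G - B) (u₂ := G - A) (u₃ := 1 + A - E) (u₄ := 1 + B - E)
    (v₁ := 1 + C - E) (v₂ := G - D) (v₃ := 1 + D - E) (v₄ := G - C)
    (w₁ := F - B) (w₂ := A) (w₃ := F - A) (w₄ := B)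
    (z := B - A) (t := A + B - F) w4 w5
    (by linear_combination -hγ - hs) (by ring) (by ring) (by ring)
    (by ring) (by linear_combination -hγ)
    (by ring) (by ring) (by linear_combination -hγ) (by linear_combination -hγ)
    (by ring) (by linear_combination -hγ - hs) (by ring) (by linear_combination -hγ - hs)
    (by ring) (by linear_combination -hγ) (by ring) (by linear_combination -hγ)
    (by ring) (by linear_combination -hγ)
    hBG hAG hAE hBE hCE hDG hDE hCG hBF hA hAF hB hAB hFAB
  have p3 : Pf (1 + G - E - F) (1 - E - F + γ) (1 - E) (γ - F) (F - 1 - B + E) (F - 1 - A + E)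
        (1 + G - E - C) (1 + G - E - D) =
      Pf (γ - F) (1 - E - F + γ) (1 + G - E - F) (1 - E) (F - 1 - B + E) (F - 1 - A + E)
        (1 + G - E - C) (1 + G - E - D) := by
    simp only [Pf]
    congr 2 <;> rw [Fstar_swap₃₄, Fstar_swap₂₃, Fstar_swap₁₂, Fstar_swap₂₃]
  have st4 := Pf_step (γ - F) (1 - E - F + γ) (1 + G - E - F) (1 - E)
    (F - 1 - B + E) (F - 1 - A + E) (1 + G - E - C) (1 + G - E - D)
    (γ - 1 - G + E + C) (γ - 1 - G + E + D) F (F - 1 + E)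
    (u₁ := G - D) (u₂ := F - D) (u₃ := G - C) (u₄ := F - C)
    (v₁ := A) (v₂ := B) (v₃ := 1 + A - E) (v₄ := 1 + B - E)
    (w₁ := G - B) (w₂ := G - A) (w₃ := F - B) (w₄ := F - A)
    (z := F - G) (t := B - A) w0 w1
    (by linear_combination -hγ) (by ring) (by ring) (by ring) (by ring)
    (by linear_combination -hγ - hs) (by linear_combination -hγ - hs)
    (by linear_combination -hγ - hs) (by linear_combination -hγ - hs)
    (by linear_combination -hγ - hs) (by linear_combination -hγ) (by linear_combination -hγ)
    (by linear_combination -hγ) (by linear_combination -hγ) (by ring) (by ring) (by ring) (by ring)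
    (by ring) (by ring) hDG hDF hCG hCF hA hB hAE hBE hBG hAG hBF hAF hFG hAB
  rw [p1] at st1
  rw [p2] at st2
  rw [p3] at st3
  have e0 : Pf A B C D 0 (1 - E) F G = Real.pi / Sn E * (Fstar A B C D E F G -
      Fstar (1 + A - E) (1 + B - E) (1 + C - E) (1 + D - E) (2 - E) (1 + F - E) (1 + G - E)) := by
    have h (X : ℂ) : X + (1 - E) = 1 + X - E := by ring
    rw [Pf, sub_zero, Sn_one_sub, show 1 + (1 - E) - 0 = 2 - E by ring,
      show 1 + 0 - (1 - E) = E by ring]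
    simp only [add_zero, h]
  have e4 : Pf (γ - 1 - G + E + C) (γ - 1 - G + E + D) (F - 1 - B + E) (F - 1 - A + E)
      (1 + G - E - F) (1 - E) F (F - 1 + E) = Real.pi / Sn (F - G) *
      (Fstar (G - A) (G - B) (G - C) (G - D) (1 + G - F) (1 + G - E) G -
      Fstar (F - A) (F - B) (F - C) (F - D) (1 + F - G) (1 + F - E) F) := by
    rw [Pf, show 1 - E - (1 + G - E - F) = F - G by ring,
      show γ - 1 - G + E + C + (1 + G - E - F) = G - D by linear_combination -hγ - hs,
      show γ - 1 - G + E + D + (1 + G - E - F) = G - C by linear_combination -hγ - hs,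
      show F - 1 - B + E + (1 + G - E - F) = G - B by ring,
      show F - 1 - A + E + (1 + G - E - F) = G - A by ring,
      show γ - 1 - G + E + C + (1 - E) = F - D by linear_combination -hγ - hs,
      show γ - 1 - G + E + D + (1 - E) = F - C by linear_combination -hγ - hs,
      show F - 1 - B + E + (1 - E) = F - B by ring,
      show F - 1 - A + E + (1 - E) = F - A by ring,
      show 1 + (1 + G - E - F) - (1 - E) = 1 + G - F by ring,
      show 1 + (1 - E) - (1 + G - E - F) = 1 + F - G by ring,
      show F + (1 + G - E - F) = 1 + G - E by ring,
      show F - 1 + E + (1 + G - E - F) = G by ring,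
      show F - 1 + E + (1 - E) = F by ring,
      show F + (1 - E) = 1 + F - E by ring]
    congr 2
    · rw [Fstar_swap₃₄, Fstar_swap₂₃, Fstar_swap₁₂, Fstar_swap₃₄, Fstar_swap₂₃, Fstar_swap₃₄]
    · rw [Fstar_swap₃₄, Fstar_swap₂₃, Fstar_swap₁₂, Fstar_swap₃₄, Fstar_swap₂₃, Fstar_swap₃₄]
  rw [e0] at st1
  rw [e4] at st4
  have hK : (Real.pi : ℂ) * (Gamma A * Gamma (1 + A - E) * Gamma B * Gamma (1 + B - E) *
      (Gamma (G - D) * Gamma (G - C) * Gamma (F - D) * Gamma (F - C))) ≠ 0 := by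
    have := Gamma_ne_zero' hA
    have := Gamma_ne_zero' hB
    have := Gamma_ne_zero' hAE
    have := Gamma_ne_zero' hBE
    have := Gamma_ne_zero' hDG
    have := Gamma_ne_zero' hCG
    have := Gamma_ne_zero' hDF
    have := Gamma_ne_zero' hCF
    have := pi_ne_zero'
    positivity
  apply mul_left_cancel₀ hK
  linear_combination (Gamma (F - B) * Gamma (A) * Gamma (F - A) * Gamma (B)) *
      (Gamma (G - B) * Gamma (G - A) * Gamma (1 + A - E) * Gamma (1 + B - E)) *
      (Gamma (G - D) * Gamma (F - D) * Gamma (G - C) * Gamma (F - C)) * st1 +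
    (Gamma (A) * Gamma (1 + A - E) * Gamma (B) * Gamma (1 + B - E)) *
      (Gamma (G - B) * Gamma (G - A) * Gamma (1 + A - E) * Gamma (1 + B - E)) *
      (Gamma (G - D) * Gamma (F - D) * Gamma (G - C) * Gamma (F - C)) * st2 +
    (Gamma (A) * Gamma (1 + A - E) * Gamma (B) * Gamma (1 + B - E)) *
      (Gamma (C) * Gamma (D) * Gamma (F - D) * Gamma (F - C)) *
      (Gamma (G - D) * Gamma (F - D) * Gamma (G - C) * Gamma (F - C)) * st3 +
    (Gamma (A) * Gamma (1 + A - E) * Gamma (B) * Gamma (1 + B - E)) *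
      (Gamma (C) * Gamma (D) * Gamma (F - D) * Gamma (F - C)) *
      (Gamma (1 + C - E) * Gamma (G - D) * Gamma (1 + D - E) * Gamma (G - C)) * st4

theorem norm_betaIntegral_le {u v : ℂ} (hu : 0 < u.re) (hv : 0 < v.re) :
    ‖betaIntegral u v‖ ≤ Real.Gamma u.re * Real.Gamma v.re / Real.Gamma (u.re + v.re) := by
  have h1 : ‖betaIntegral u v‖ ≤ ∫ x in (0:ℝ)..1, ‖(x:ℂ) ^ (u - 1) * (1 - (x:ℂ)) ^ (v - 1)‖ :=
    intervalIntegral.norm_integral_le_integral_norm zero_le_one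
  have h2 : ((∫ x in (0:ℝ)..1, ‖(x:ℂ) ^ (u - 1) * (1 - (x:ℂ)) ^ (v - 1)‖ : ℝ) : ℂ) =
      betaIntegral u.re v.re := by
    rw [betaIntegral, ← intervalIntegral.integral_ofReal]
    refine intervalIntegral.integral_congr_ae ?_
    have : ∀ᵐ x : ℝ, x ≠ 1 := by simp [MeasureTheory.ae_iff]
    filter_upwards [this] with x hx1 hx
    rw [Set.uIoc_of_le zero_le_one] at hx
    have hx' : 0 < 1 - x := sub_pos.2 (lt_of_le_of_ne hx.2 hx1)
    have e : (1 - (x:ℂ)) = ((1 - x : ℝ) : ℂ) := by push_cast; ring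
    rw [norm_mul, e, norm_cpow_eq_rpow_re_of_pos hx.1, norm_cpow_eq_rpow_re_of_pos hx']
    rw [ofReal_mul, ofReal_cpow hx.1.le, ofReal_cpow hx'.le]
    simp
  have h3 := Gamma_mul_Gamma_eq_betaIntegral (s := u.re) (t := v.re) (by simpa) (by simpa)
  rw [← h2, ← ofReal_add, Gamma_ofReal, Gamma_ofReal, Gamma_ofReal] at h3
  rw [← ofReal_mul, ← ofReal_mul] at h3
  have h3 := ofReal_injective h3
  rw [h3, mul_div_cancel_left₀ _ (Real.Gamma_pos_of_pos (by linarith)).ne']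
  exact h1

theorem norm_Gamma_div_le {z δ : ℂ} (hz : 0 < z.re) (hδ : 0 < δ.re) :
    ‖Gamma z / Gamma (z + δ)‖ ≤
      Real.Gamma δ.re / ‖Gamma δ‖ * (Real.Gamma z.re / Real.Gamma (z.re + δ.re)) := by
  have h := Gamma_mul_Gamma_eq_betaIntegral hz hδ
  have h1 : Gamma (z + δ) ≠ 0 := Gamma_ne_zero_of_re_pos (by simp; linarith)
  have h2 : Gamma δ ≠ 0 := Gamma_ne_zero_of_re_pos hδ
  have h3 : Gamma z / Gamma (z + δ) = betaIntegral z δ / Gamma δ := by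
    field_simp
    linear_combination h
  rw [h3, norm_div]
  calc _ ≤ (Real.Gamma z.re * Real.Gamma δ.re / Real.Gamma (z.re + δ.re)) / ‖Gamma δ‖ := by
        gcongr
        exact norm_betaIntegral_le hz hδ
    _ = _ := by ring

theorem real_Gamma_div_le {x δ : ℝ} (hx : 0 < x) (h0 : 0 < δ) (h1 : δ < 1) :
    Real.Gamma x / Real.Gamma (x + δ) ≤ (x + δ) ^ (1 - δ) / x := by
  have hxd : 0 < x + δ := by linarith
  have hg := Real.Gamma_pos_of_pos hxd
  have h := Real.Gamma_mul_add_mul_le_rpow_Gamma_mul_rpow_Gamma (s := x + δ) (t := x + δ + 1)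
    (a := δ) (b := 1 - δ) hxd (by linarith) h0 (by linarith) (by ring)
  rw [show δ * (x + δ) + (1 - δ) * (x + δ + 1) = x + 1 by ring, Real.Gamma_add_one hx.ne',
    Real.Gamma_add_one hxd.ne', Real.mul_rpow hxd.le hg.le, mul_comm ((x + δ) ^ (1 - δ)),
    ← mul_assoc, ← Real.rpow_add hg] at h
  rw [show δ + (1 - δ) = 1 by ring, Real.rpow_one] at h
  rw [div_le_div_iff₀ hg hx]
  linarith

theorem Gamma_ratio_bound {x δ : ℂ} (hx : 0 < x.re) (h0 : 0 < δ.re) (h1 : δ.re < 1) :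
    ∃ C : ℝ, 0 < C ∧ ∀ s : ℂ, 0 ≤ s.re →
      ‖Gamma (x + s) / Gamma (x + δ + s)‖ ≤ C * (1 + s.re) ^ (-δ.re) := by
  have hG : 0 < Real.Gamma δ.re / ‖Gamma δ‖ :=
    div_pos (Real.Gamma_pos_of_pos h0) (norm_pos_iff.2 (Gamma_ne_zero_of_re_pos h0))
  set m := min x.re 1 with hm
  have hm0 : 0 < m := lt_min hx one_pos
  refine ⟨Real.Gamma δ.re / ‖Gamma δ‖ * ((x.re + 1) ^ (1 - δ.re) / m), by positivity, ?_⟩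
  intro s hs
  have hxs : 0 < (x + s).re := by simp; linarith
  have hA := norm_Gamma_div_le hxs h0
  have hB := real_Gamma_div_le hxs h0 h1
  rw [show x + δ + s = x + s + δ by ring]
  refine hA.trans ?_
  rw [mul_assoc]
  gcongr
  refine hB.trans ?_
  have hl : m * (1 + s.re) ≤ (x + s).re := by
    have := min_le_left x.re 1
    have := min_le_right x.re 1
    simp only [add_re]
    nlinarith
  have hu : (x + s).re + δ.re ≤ (x.re + 1) * (1 + s.re) := by
    simp only [add_re]
    nlinarith
  have h1s : 0 < 1 + s.re := by linarith
  calc ((x + s).re + δ.re) ^ (1 - δ.re) / (x + s).re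
      ≤ ((x.re + 1) * (1 + s.re)) ^ (1 - δ.re) / (m * (1 + s.re)) := by
        gcongr
    _ = _ := by
        rw [Real.mul_rpow (by linarith) h1s.le, show 1 - δ.re = 1 + -δ.re by ring,
          Real.rpow_add h1s, Real.rpow_one]
        field_simp

theorem norm_Sn_le (z : ℂ) : ‖Sn z‖ ≤ Real.exp (Real.pi * |z.im|) := by
  rw [Sn, Complex.sin]
  have h1 : ‖exp (-(Real.pi * z) * I)‖ ≤ Real.exp (Real.pi * |z.im|) := by
    rw [norm_exp]
    apply Real.exp_le_exp.2
    have := le_abs_self z.im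
    have := Real.pi_pos
    simp
    nlinarith
  have h2 : ‖exp (Real.pi * z * I)‖ ≤ Real.exp (Real.pi * |z.im|) := by
    rw [norm_exp]
    apply Real.exp_le_exp.2
    have := neg_abs_le z.im
    have := Real.pi_pos
    simp
    nlinarith
  rw [norm_div, norm_mul, norm_I, mul_one]
  have := norm_sub_le (exp (-(Real.pi * z) * I)) (exp (Real.pi * z * I))
  have h2n : ‖(2:ℂ)‖ = 2 := by simp
  rw [h2n]
  linarith

theorem inv_Gamma_one_sub_of_ne {z : ℂ} (hz : Gamma z ≠ 0) :
    (Gamma (1 - z))⁻¹ = Gamma z * Sn z / Real.pi := by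
  have h := Gamma_mul_Gamma_one_sub' z
  have : Gamma (1 - z) = Real.pi / Sn z / Gamma z := by
    field_simp; linear_combination h
  rw [this, inv_div, div_div_eq_mul_div]

def phi (x y s : ℂ) : ℂ := (Gamma (1 - x - s))⁻¹ * (Gamma (y + s))⁻¹

theorem phi_neg (x y s : ℂ) : phi x y (-s) = phi (1 - y) (1 - x) s := by
  rw [phi, phi, mul_comm]; ring_nf

theorem norm_phi_le {x y : ℂ} (hx : 0 < x.re) (h0 : x.re < y.re) (h1 : y.re < x.re + 1) :
    ∃ C : ℝ, 0 < C ∧ ∀ s : ℂ, 0 ≤ s.re →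
      ‖phi x y s‖ ≤ C * (Real.exp (Real.pi * |s.im|) * (1 + s.re) ^ (-(y.re - x.re))) := by
  obtain ⟨C, hC, h⟩ := Gamma_ratio_bound (x := x) (δ := y - x) hx (by simpa) (by simp; linarith)
  refine ⟨C * Real.exp (Real.pi * |x.im|), by positivity, fun s hs => ?_⟩
  have hz : Gamma (x + s) ≠ 0 := Gamma_ne_zero_of_re_pos (by simp; linarith)
  have e : phi x y s = Gamma (x + s) / Gamma (x + (y - x) + s) * (Sn (x + s) / Real.pi) := by
    rw [phi, sub_sub, inv_Gamma_one_sub_of_ne hz, add_sub_cancel]; ring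
  have hS : ‖Sn (x + s) / Real.pi‖ ≤ Real.exp (Real.pi * |x.im|) * Real.exp (Real.pi * |s.im|) := by
    rw [norm_div, norm_real, Real.norm_of_nonneg Real.pi_pos.le, ← Real.exp_add]
    refine (div_le_self (norm_nonneg _) (by linarith [Real.pi_gt_three])).trans ?_
    refine (norm_Sn_le _).trans (Real.exp_le_exp.2 ?_)
    have := abs_add_le x.im s.im
    rw [add_im]
    nlinarith [Real.pi_pos]
  rw [e, norm_mul]
  have h2 := h s hs
  rw [sub_re] at h2
  calc _ ≤ (C * (1 + s.re) ^ (-(y.re - x.re))) *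
        (Real.exp (Real.pi * |x.im|) * Real.exp (Real.pi * |s.im|)) := by gcongr
    _ = _ := by ring

theorem norm_inv_Gamma_one_sub_le : ∃ C : ℝ, 0 < C ∧ ∀ z : ℂ, -1 < z.re →
    ‖(Gamma (1 - z))⁻¹‖ ≤ C * (Real.exp (Real.pi * |z.im|) * ‖Gamma (z + 1)‖ * (1 + ‖z‖)⁻¹) := by
  have hcont : Continuous fun z : ℂ => (Gamma (1 - z))⁻¹ * (Gamma (z + 1))⁻¹ := by
    have h := differentiable_one_div_Gamma.continuous
    exact (h.comp (continuous_const.sub continuous_id)).mul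
      (h.comp (continuous_id.add continuous_const))
  obtain ⟨M, hM⟩ := (isCompact_closedBall (0 : ℂ) 1).exists_bound_of_continuousOn
    hcont.continuousOn
  refine ⟨2 * max M 1, by positivity, fun z hz => ?_⟩
  have hG : Gamma (z + 1) ≠ 0 := Gamma_ne_zero_of_re_pos (by simp; linarith)
  have hexp : 1 ≤ Real.exp (Real.pi * |z.im|) := Real.one_le_exp (by positivity)
  have hM1 := le_max_left M 1
  have hM2 := le_max_right M 1
  rcases le_total ‖z‖ 1 with h | h
  · have h1 := hM z (by simpa using h)
    rw [norm_mul] at h1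
    have hGp : 0 < ‖Gamma (z + 1)‖ := norm_pos_iff.2 hG
    have h2 : ‖(Gamma (1 - z))⁻¹‖ ≤ max M 1 * ‖Gamma (z + 1)‖ := by
      rw [norm_inv (Gamma (z + 1)), ← div_eq_mul_inv, div_le_iff₀ hGp] at h1
      exact h1.trans (by gcongr)
    have h3 : 1 ≤ 2 * (1 + ‖z‖)⁻¹ := by
      rw [← div_eq_mul_inv, le_div_iff₀ (by positivity)]; linarith
    calc _ ≤ max M 1 * ‖Gamma (z + 1)‖ * (2 * (1 + ‖z‖)⁻¹) * Real.exp (Real.pi * |z.im|) := by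
          refine h2.trans ?_
          rw [mul_assoc (max M 1 * _)]
          apply le_mul_of_one_le_right (by positivity)
          exact one_le_mul_of_one_le_of_one_le h3 hexp
      _ = _ := by ring
  · have hz0 : z ≠ 0 := by rintro rfl; norm_num at h
    have hGz : Gamma z ≠ 0 := by
      intro h0
      rw [Gamma_add_one _ hz0, h0, mul_zero] at hG
      exact hG rfl
    rw [inv_Gamma_one_sub_of_ne hGz, Gamma_add_one _ hz0, norm_mul z, norm_div, norm_mul, norm_real,
      Real.norm_of_nonneg Real.pi_pos.le]
    have h3 : 1 ≤ 2 * (‖z‖ * (1 + ‖z‖)⁻¹) := by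
      rw [← div_eq_mul_inv, ← mul_div_assoc, le_div_iff₀ (by positivity)]; linarith
    calc _ ≤ ‖Gamma z‖ * Real.exp (Real.pi * |z.im|) := by
          refine (div_le_self (by positivity) (by linarith [Real.pi_gt_three])).trans ?_
          gcongr
          exact norm_Sn_le z
      _ ≤ ‖Gamma z‖ * Real.exp (Real.pi * |z.im|) * (max M 1 * (2 * (‖z‖ * (1 + ‖z‖)⁻¹))) := by
          apply le_mul_of_one_le_right (by positivity)
          exact one_le_mul_of_one_le_of_one_le hM2 h3
      _ = _ := by ring

theorem norm_phi_le' {x y : ℂ} (hx : -1 < x.re) (h0 : x.re + 1 < y.re) (h1 : y.re < x.re + 2) :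
    ∃ C : ℝ, 0 < C ∧ ∀ s : ℂ, 0 ≤ s.re →
      ‖phi x y s‖ ≤ C * (Real.exp (Real.pi * |s.im|) * (1 + s.re) ^ (-(y.re - x.re) + 1 / 2) *
        (1 + |s.im|) ^ (-(1 / 2) : ℝ)) := by
  obtain ⟨C, hC, h⟩ := Gamma_ratio_bound (x := x + 1) (δ := y - x - 1) (by simp; linarith)
    (by simp; linarith) (by simp; linarith)
  obtain ⟨C', hC', h'⟩ := norm_inv_Gamma_one_sub_le
  refine ⟨C * C' * Real.exp (Real.pi * |x.im|) * (1 + ‖x‖), by positivity, fun s hs => ?_⟩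
  have g1 := h' (x + s) (by simp; linarith)
  have g2 := h s hs
  rw [show x + 1 + (y - x - 1) + s = y + s by ring, norm_div, div_eq_mul_inv,
    show x + 1 + s = x + s + 1 by ring] at g2
  simp only [sub_re, one_re] at g2
  have hS : Real.exp (Real.pi * |(x + s).im|) ≤
      Real.exp (Real.pi * |x.im|) * Real.exp (Real.pi * |s.im|) := by
    rw [← Real.exp_add]
    refine Real.exp_le_exp.2 ?_
    have := abs_add_le x.im s.im
    rw [add_im]
    nlinarith [Real.pi_pos]
  have hn : (1 + ‖x + s‖)⁻¹ ≤ (1 + ‖x‖) * ((1 + s.re) ^ (-(1 / 2) : ℝ) *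
      (1 + |s.im|) ^ (-(1 / 2) : ℝ)) := by
    have a1 : 1 + ‖s‖ ≤ (1 + ‖x + s‖) * (1 + ‖x‖) := by
      have : ‖s‖ ≤ ‖x + s‖ + ‖x‖ := by
        have := norm_sub_le (x + s) x
        rwa [add_sub_cancel_left] at this
      nlinarith [norm_nonneg x, norm_nonneg (x + s)]
    have a2 : (1 + s.re) ^ (1 / 2 : ℝ) * (1 + |s.im|) ^ (1 / 2 : ℝ) ≤ 1 + ‖s‖ := by
      rw [← Real.mul_rpow (by linarith) (by positivity), ← Real.sqrt_eq_rpow]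
      apply Real.sqrt_le_iff.2
      have b1 := (le_abs_self _).trans (abs_re_le_norm s)
      have b2 := abs_im_le_norm s
      refine ⟨by positivity, ?_⟩
      rw [sq]
      gcongr
    rw [Real.rpow_neg (by linarith), Real.rpow_neg (by positivity), ← mul_inv,
      ← div_eq_mul_inv, inv_eq_one_div, div_le_div_iff₀ (by positivity) (by positivity)]
    linarith
  have hr : (1 + s.re) ^ (-(y.re - x.re) + 1 / 2) =
      (1 + s.re) ^ (-(y.re - x.re - 1)) * (1 + s.re) ^ (-(1 / 2) : ℝ) := by
    rw [← Real.rpow_add (by linarith)]; ring_nf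
  rw [phi, sub_sub, norm_mul, norm_inv (Gamma (y + s)), hr]
  calc _ ≤ C' * (Real.exp (Real.pi * |(x + s).im|) * ‖Gamma (x + s + 1)‖ * (1 + ‖x + s‖)⁻¹) *
        ‖Gamma (y + s)‖⁻¹ := by gcongr
    _ = C' * Real.exp (Real.pi * |(x + s).im|) * (‖Gamma (x + s + 1)‖ * ‖Gamma (y + s)‖⁻¹) *
        (1 + ‖x + s‖)⁻¹ := by ring
    _ ≤ C' * (Real.exp (Real.pi * |x.im|) * Real.exp (Real.pi * |s.im|)) *
        (C * (1 + s.re) ^ (-(y.re - x.re - 1))) * ((1 + ‖x‖) * ((1 + s.re) ^ (-(1 / 2) : ℝ) *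
      (1 + |s.im|) ^ (-(1 / 2) : ℝ))) := by gcongr
    _ = _ := by ring

def bilatTerm (x y : Fin 4 → ℂ) (s : ℂ) : ℂ := ∏ i, phi (x i) (y i) s

def bilatSum (x y : Fin 4 → ℂ) (s : ℂ) : ℂ := ∑' n : ℤ, bilatTerm x y (s + n)

structure BilatParams (x y : Fin 4 → ℂ) : Prop where
  lower : -1 < (x 0).re
  left : (x 0).re + 1 < (y 0).re
  right : (y 0).re < (x 0).re + 2
  upper : (y 0).re < 2
  pos : ∀ i : Fin 3, 0 < (x i.succ).re
  lt : ∀ i : Fin 3, (x i.succ).re < (y i.succ).re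
  lt_one : ∀ i : Fin 3, (y i.succ).re < 1
  sum : (y 0).re + (y 1).re + (y 2).re + (y 3).re =
    (x 0).re + (x 1).re + (x 2).re + (x 3).re + 2

theorem BilatParams.dual {x y : Fin 4 → ℂ} (h : BilatParams x y) :
    BilatParams (fun i => 1 - y i) (fun i => 1 - x i) where
  lower := by have := h.upper; simp; linarith
  left := by have := h.left; simp; linarith
  right := by have := h.right; simp; linarith
  upper := by have := h.lower; simp; linarith
  pos i := by have := h.lt_one i; simp; linarith
  lt i := by have := h.lt i; simp; linarith
  lt_one i := by have := h.pos i; simp; linarith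
  sum := by have := h.sum; simp; linarith

theorem bilatTerm_neg (x y : Fin 4 → ℂ) (s : ℂ) :
    bilatTerm x y (-s) = bilatTerm (fun i => 1 - y i) (fun i => 1 - x i) s :=
  Finset.prod_congr rfl fun _ _ => phi_neg _ _ _

theorem BilatParams.norm_le_of_re_nonneg {x y : Fin 4 → ℂ} (h : BilatParams x y) :
    ∃ C : ℝ, 0 < C ∧ ∀ s : ℂ, 0 ≤ s.re →
      ‖bilatTerm x y s‖ ≤ C * (Real.exp (4 * Real.pi * |s.im|) *
        (1 + |s.im|) ^ (-(1 / 2) : ℝ) * (1 + |s.re|) ^ (-(3 / 2) : ℝ)) := by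
  obtain ⟨C0, p0, h0⟩ := norm_phi_le' h.lower h.left h.right
  have hb : ∀ i : Fin 3, _ := fun i => norm_phi_le (h.pos i) (h.lt i)
    (by have := h.pos i; have := h.lt_one i; linarith)
  obtain ⟨C1, p1, h1⟩ := hb 0
  obtain ⟨C2, p2, h2⟩ := hb 1
  obtain ⟨C3, p3, h3⟩ := hb 2
  refine ⟨C0 * C1 * C2 * C3, by positivity, fun s hs => ?_⟩
  have hs1 : 0 < 1 + s.re := by linarith
  rw [bilatTerm, Fin.prod_univ_four, norm_mul, norm_mul, norm_mul, abs_of_nonneg hs]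
  have e1 : Real.exp (4 * Real.pi * |s.im|) = Real.exp (Real.pi * |s.im|) *
      Real.exp (Real.pi * |s.im|) * Real.exp (Real.pi * |s.im|) * Real.exp (Real.pi * |s.im|) := by
    simp only [← Real.exp_add]; ring_nf
  have e2 : (1 + s.re) ^ (-(3 / 2) : ℝ) = (1 + s.re) ^ (-((y 0).re - (x 0).re) + 1 / 2) *
      (1 + s.re) ^ (-((y 1).re - (x 1).re)) * (1 + s.re) ^ (-((y 2).re - (x 2).re)) *
      (1 + s.re) ^ (-((y 3).re - (x 3).re)) := by
    simp only [← Real.rpow_add hs1]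
    congr 1
    linarith [h.sum]
  calc _ ≤ (C0 * (Real.exp (Real.pi * |s.im|) * (1 + s.re) ^ (-((y 0).re - (x 0).re) + 1 / 2) *
        (1 + |s.im|) ^ (-(1 / 2) : ℝ))) *
        (C1 * (Real.exp (Real.pi * |s.im|) * (1 + s.re) ^ (-((y 1).re - (x 1).re)))) *
        (C2 * (Real.exp (Real.pi * |s.im|) * (1 + s.re) ^ (-((y 2).re - (x 2).re)))) *
        (C3 * (Real.exp (Real.pi * |s.im|) * (1 + s.re) ^ (-((y 3).re - (x 3).re)))) := by
        gcongr
        exacts [h0 s hs, h1 s hs, h2 s hs, h3 s hs]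
    _ = _ := by rw [e1, e2]; ring

theorem BilatParams.norm_le {x y : Fin 4 → ℂ} (h : BilatParams x y) :
    ∃ C : ℝ, 0 < C ∧ ∀ s : ℂ,
      ‖bilatTerm x y s‖ ≤ C * (Real.exp (4 * Real.pi * |s.im|) *
        (1 + |s.im|) ^ (-(1 / 2) : ℝ) * (1 + |s.re|) ^ (-(3 / 2) : ℝ)) := by
  obtain ⟨C, hC, h1⟩ := h.norm_le_of_re_nonneg
  obtain ⟨C', hC', h2⟩ := h.dual.norm_le_of_re_nonneg
  refine ⟨max C C', by positivity, fun s => ?_⟩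
  rcases le_total 0 s.re with hs | hs
  · exact (h1 s hs).trans (by gcongr; exact le_max_left _ _)
  · have := h2 (-s) (by simpa)
    rw [← bilatTerm_neg, neg_neg, neg_re, neg_im, abs_neg, abs_neg] at this
    exact this.trans (by gcongr; exact le_max_right _ _)

theorem summable_one_add_abs_int : Summable fun n : ℤ => (1 + |(n : ℝ)|) ^ (-(3 / 2) : ℝ) := by
  refine Summable.of_nat_of_neg ?_ ?_ <;>
  · have := (Real.summable_one_div_nat_add_rpow 1 (3 / 2)).2 (by norm_num)
    refine this.congr fun n => ?_
    have h : (0 : ℝ) ≤ n := n.cast_nonneg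
    simp only [Int.cast_neg, abs_neg, Int.cast_natCast, abs_of_nonneg h]
    rw [abs_of_nonneg (by linarith), Real.rpow_neg (by linarith), one_div, add_comm]

theorem BilatParams.norm_shift_le {x y : Fin 4 → ℂ} (h : BilatParams x y) :
    ∃ C : ℝ, 0 < C ∧ ∀ (s : ℂ) (n : ℤ),
      ‖bilatTerm x y (s + n)‖ ≤ C * (Real.exp (4 * Real.pi * |s.im|) *
        (1 + |s.im|) ^ (-(1 / 2) : ℝ) * (1 + |s.re|) ^ (3 / 2 : ℝ)) *
        (1 + |(n : ℝ)|) ^ (-(3 / 2) : ℝ) := by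
  obtain ⟨C, hC, h1⟩ := h.norm_le
  refine ⟨C, hC, fun s n => ?_⟩
  have h2 := h1 (s + n)
  rw [add_im, intCast_im, add_zero, add_re, intCast_re] at h2
  refine h2.trans ?_
  rw [mul_assoc C, mul_assoc (_ * _)]
  gcongr
  have h3 : 1 + |(n : ℝ)| ≤ (1 + |s.re + n|) * (1 + |s.re|) := by
    have : |(n : ℝ)| ≤ |s.re + n| + |s.re| := by
      have := abs_sub (s.re + n) s.re
      rwa [add_sub_cancel_left] at this
    nlinarith [abs_nonneg s.re, abs_nonneg (s.re + n)]
  rw [Real.rpow_neg (by positivity), Real.rpow_neg (by positivity), ← div_eq_mul_inv,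
    inv_eq_one_div, div_le_div_iff₀ (by positivity) (by positivity), one_mul, mul_comm,
    ← Real.mul_rpow (by positivity) (by positivity)]
  exact Real.rpow_le_rpow (by positivity) h3 (by norm_num)

theorem differentiable_bilatTerm (x y : Fin 4 → ℂ) : Differentiable ℂ (bilatTerm x y) := by
  have h : ∀ u v, Differentiable ℂ (phi u v) := fun u v => by
    unfold phi
    have := differentiable_one_div_Gamma
    exact (this.comp (differentiable_id.const_sub (1 - u))).mul
      (this.comp (differentiable_id.const_add v))
  unfold bilatTerm
  fun_prop

theorem BilatParams.differentiable {x y : Fin 4 → ℂ} (h : BilatParams x y) :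
    Differentiable ℂ (bilatSum x y) := by
  obtain ⟨C, hC, h1⟩ := h.norm_shift_le
  intro s
  set R := ‖s‖ + 1
  have hd : DifferentiableOn ℂ (bilatSum x y) (Metric.ball 0 R) := by
    refine differentiableOn_tsum_of_summable_norm
      (u := fun n : ℤ => C * (Real.exp (4 * Real.pi * R) * 1 * (1 + R) ^ (3 / 2 : ℝ)) *
        (1 + |(n : ℝ)|) ^ (-(3 / 2) : ℝ)) (summable_one_add_abs_int.mul_left _) (fun n => ?_)
      Metric.isOpen_ball fun n w hw => (h1 w n).trans ?_
    · exact ((differentiable_bilatTerm x y).comp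
        (differentiable_id.add_const (n : ℂ))).differentiableOn
    · have hw' : ‖w‖ < R := by simpa using hw
      have i1 := (abs_im_le_norm w).trans hw'.le
      have i2 := (abs_re_le_norm w).trans hw'.le
      gcongr
      exact Real.rpow_le_one_of_one_le_of_nonpos (by linarith [abs_nonneg w.im]) (by norm_num)
  exact hd.differentiableAt (Metric.isOpen_ball.mem_nhds (by simp [R]))

theorem bilatSum_periodic (x y : Fin 4 → ℂ) : Function.Periodic (bilatSum x y) 1 := by
  intro s
  rw [bilatSum, bilatSum,
    ← (Equiv.addLeft (1 : ℤ)).tsum_eq fun n : ℤ => bilatTerm x y (s + n)]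
  refine tsum_congr fun n => ?_
  simp [add_assoc]

theorem BilatParams.growth {x y : Fin 4 → ℂ} (h : BilatParams x y) {ε : ℝ} (hε : 0 < ε) :
    ∃ T : ℝ, ∀ s : ℂ, T ≤ |s.im| → ‖bilatSum x y s‖ ≤ ε * Real.exp (4 * Real.pi * |s.im|) := by
  obtain ⟨C, hC, h1⟩ := h.norm_shift_le
  set M := ∑' n : ℤ, (1 + |(n : ℝ)|) ^ (-(3 / 2) : ℝ)
  have hM : 0 ≤ M := tsum_nonneg fun n => by positivity
  have hlim : Tendsto (fun t : ℝ => C * M * 2 ^ (3 / 2 : ℝ) * (1 + t) ^ (-(1 / 2) : ℝ)) atTop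
      (𝓝 0) := by
    have h2 := (tendsto_rpow_neg_atTop (y := 1 / 2) (by norm_num)).comp
      (tendsto_atTop_add_const_left atTop (1 : ℝ) tendsto_id)
    have := h2.const_mul (C * M * 2 ^ (3 / 2 : ℝ))
    simpa using this
  obtain ⟨T, hT⟩ := eventually_atTop.1 (hlim.eventually (ge_mem_nhds hε))
  refine ⟨T, fun s hs => ?_⟩
  set s' : ℂ := s - ⌊s.re⌋
  have hs' : bilatSum x y s = bilatSum x y s' := by
    have := (bilatSum_periodic x y).sub_zsmul_eq ⌊s.re⌋ (x := s)
    simpa [s'] using this.symm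
  have him : s'.im = s.im := by simp [s']
  have hre : |s'.re| ≤ 1 := by
    have : s'.re = Int.fract s.re := by simp [s', ← Int.self_sub_floor]
    rw [this, abs_of_nonneg (Int.fract_nonneg _)]
    exact (Int.fract_lt_one _).le
  have hb := tsum_of_norm_bounded (summable_one_add_abs_int.hasSum.mul_left _) (h1 s')
  rw [hs', bilatSum]
  refine hb.trans ?_
  rw [him]
  calc _ ≤ C * (Real.exp (4 * Real.pi * |s.im|) * (1 + |s.im|) ^ (-(1 / 2) : ℝ) *
        (2 : ℝ) ^ (3 / 2 : ℝ)) * M := by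
        gcongr
        linarith
    _ = (C * M * 2 ^ (3 / 2 : ℝ) * (1 + |s.im|) ^ (-(1 / 2) : ℝ)) *
        Real.exp (4 * Real.pi * |s.im|) := by ring
    _ ≤ _ := by
        gcongr
        exact hT _ hs

theorem eq_zero_of_isLittleO_pow_card (Z : Finset ℂ) : ∀ {Ψ : ℂ → ℂ}, Differentiable ℂ Ψ →
    (∀ z ∈ Z, Ψ z = 0) → Ψ =o[cocompact ℂ] (fun q => q ^ Z.card) → ∀ q, Ψ q = 0 := by
  induction Z using Finset.induction_on with
  | empty =>
    intro Ψ hd _ ho q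
    refine hd.apply_eq_of_tendsto_cocompact q ?_
    simpa [Asymptotics.isLittleO_one_iff] using ho
  | insert z Z hz ih =>
    intro Ψ hd h0 ho q
    have hΨ : ∀ q, Ψ q = (q - z) * dslope Ψ z q := fun q => by
      have := sub_smul_dslope Ψ z q
      rw [h0 z (Finset.mem_insert_self z Z), sub_zero, smul_eq_mul] at this
      exact this.symm
    rw [hΨ, ih (Ψ := dslope Ψ z), mul_zero]
    · intro w
      exact ((differentiableOn_dslope (s := Set.univ) univ_mem).2 hd.differentiableOn).differentiableAt
        univ_mem
    · intro w hw
      have hwz : w - z ≠ 0 := sub_ne_zero.2 fun h => hz (h ▸ hw)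
      have := hΨ w
      rw [h0 w (Finset.mem_insert_of_mem hw)] at this
      exact (mul_eq_zero.1 this.symm).resolve_left hwz
    · rw [Finset.card_insert_of_notMem hz] at ho
      have hO : (fun q : ℂ => q ^ (Z.card + 1)) =O[cocompact ℂ]
          fun q => (q - z) * q ^ Z.card := by
        refine Asymptotics.IsBigO.of_bound 2 ?_
        have : ∀ᶠ q : ℂ in cocompact ℂ, 2 * ‖z‖ ≤ ‖q‖ :=
          tendsto_norm_cocompact_atTop.eventually_ge_atTop _
        filter_upwards [this] with q hq
        rw [pow_succ', norm_mul, norm_mul, ← mul_assoc]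
        gcongr
        have := norm_sub_norm_le q z
        linarith
      have h2 := ho.trans_isBigO hO
      rw [Asymptotics.isLittleO_iff] at h2 ⊢
      intro ε hε
      have : ∀ᶠ q : ℂ in cocompact ℂ, ‖z‖ + 1 ≤ ‖q‖ :=
        tendsto_norm_cocompact_atTop.eventually_ge_atTop _
      filter_upwards [h2 hε, this] with q hq hqz
      rw [hΨ, norm_mul, norm_mul, mul_left_comm] at hq
      refine le_of_mul_le_mul_left hq ?_
      have := norm_sub_norm_le q z
      linarith

theorem eq_zero_of_periodic {f : ℂ → ℂ} (hf : Differentiable ℂ f) (hp : Function.Periodic f 1)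
    (hg : ∀ ε > 0, ∃ T : ℝ, ∀ s : ℂ, T ≤ |s.im| → ‖f s‖ ≤ ε * Real.exp (4 * Real.pi * |s.im|))
    {u v w : ℂ} (hu : f u = 0) (hv : f v = 0) (hw : f w = 0)
    (huv : ∀ n : ℤ, u - v ≠ n) (huw : ∀ n : ℤ, u - w ≠ n) (hvw : ∀ n : ℤ, v - w ≠ n) (s : ℂ) :
    f s = 0 := by
  set g := Function.Periodic.cuspFunction 1 f
  have hp' : Function.Periodic f ((1 : ℝ) : ℂ) := by simpa using hp
  set Q : ℂ → ℂ := Function.Periodic.qParam 1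
  have hgQ : ∀ z, g (Q z) = f z := Function.Periodic.eq_cuspFunction one_ne_zero hp'
  have hQ0 : ∀ z, Q z ≠ 0 := fun z => Function.Periodic.qParam_ne_zero z
  have hQn : ∀ z, ‖Q z‖ = Real.exp (-2 * Real.pi * z.im) := fun z => by
    simpa using Function.Periodic.norm_qParam 1 z
  have hsurj : ∀ q, q ≠ 0 → ∃ z, Q z = q := fun q hq =>
    ⟨_, Function.Periodic.qParam_right_inv one_ne_zero hq⟩
  have hinj : ∀ z w : ℂ, (∀ n : ℤ, z - w ≠ n) → Q z ≠ Q w := by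
    intro z w h he
    simp only [Q, Function.Periodic.qParam, ofReal_one, div_one] at he
    obtain ⟨n, hn⟩ := exp_eq_exp_iff_exists_int.1 he
    refine h n ?_
    have : (2 * Real.pi * I : ℂ) ≠ 0 := two_pi_I_ne_zero
    apply mul_left_cancel₀ this
    linear_combination hn
  set Φ : ℂ → ℂ := fun q => q ^ 2 * g q
  have hd0 : ∀ q, q ≠ 0 → DifferentiableAt ℂ Φ q := by
    intro q hq
    obtain ⟨z, rfl⟩ := hsurj q hq
    exact (differentiableAt_id.pow 2).mul
      (Function.Periodic.differentiableAt_cuspFunction one_ne_zero hp' (hf z))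
  have hΦ0 : Φ 0 = 0 := by simp [Φ]
  have hsmall : ∀ ε > 0, ∃ r > 0, ∀ q, ‖q‖ ≤ r → ‖Φ q‖ ≤ ε := by
    intro ε hε
    obtain ⟨T, hT⟩ := hg ε hε
    refine ⟨Real.exp (-2 * Real.pi * max T 0), Real.exp_pos _, fun q hq => ?_⟩
    rcases eq_or_ne q 0 with rfl | hq0
    · rw [hΦ0, norm_zero]; exact hε.le
    obtain ⟨z, rfl⟩ := hsurj q hq0
    rw [hQn, Real.exp_le_exp] at hq
    have hz : max T 0 ≤ z.im := by nlinarith [Real.pi_pos]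
    have hz0 : 0 ≤ z.im := (le_max_right _ _).trans hz
    have := hT z (by rw [abs_of_nonneg hz0]; exact (le_max_left _ _).trans hz)
    rw [abs_of_nonneg hz0] at this
    simp only [Φ]
    rw [norm_mul, hgQ, norm_pow, hQn]
    calc _ ≤ Real.exp (-2 * Real.pi * z.im) ^ 2 * (ε * Real.exp (4 * Real.pi * z.im)) := by gcongr
      _ = ε * Real.exp (-2 * Real.pi * z.im + -2 * Real.pi * z.im + 4 * Real.pi * z.im) := by
        rw [Real.exp_add, Real.exp_add]; ring
      _ = ε := by ring_nf; simp
  have hcont : ContinuousAt Φ 0 := by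
    rw [Metric.continuousAt_iff]
    intro ε hε
    obtain ⟨r, hr, h⟩ := hsmall (ε / 2) (by positivity)
    refine ⟨r, hr, fun {q} hq => ?_⟩
    rw [dist_zero_right] at hq
    rw [hΦ0, dist_zero_right]
    linarith [h q hq.le]
  have hd : Differentiable ℂ Φ := by
    have := (differentiableOn_compl_singleton_and_continuousAt_iff (f := Φ) (c := 0)
      (s := Set.univ) univ_mem).1
      ⟨fun q hq => (hd0 q hq.2).differentiableWithinAt, hcont⟩
    exact fun q => this.differentiableAt univ_mem
  have hlarge : Φ =o[cocompact ℂ] fun q => q ^ 4 := by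
    rw [Asymptotics.isLittleO_iff]
    intro ε hε
    obtain ⟨T, hT⟩ := hg ε hε
    have : ∀ᶠ q : ℂ in cocompact ℂ, Real.exp (2 * Real.pi * max T 0) ≤ ‖q‖ :=
      tendsto_norm_cocompact_atTop.eventually_ge_atTop _
    filter_upwards [this] with q hq
    have hq0 : q ≠ 0 := norm_pos_iff.1 ((Real.exp_pos _).trans_le hq)
    obtain ⟨z, rfl⟩ := hsurj q hq0
    rw [hQn, Real.exp_le_exp] at hq
    have hz : max T 0 ≤ -z.im := by nlinarith [Real.pi_pos]
    have hz0 : z.im ≤ 0 := by linarith [le_max_right T 0]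
    have := hT z (by rw [abs_of_nonpos hz0]; exact (le_max_left _ _).trans hz)
    rw [abs_of_nonpos hz0] at this
    simp only [Φ]
    rw [norm_mul, hgQ, norm_pow, norm_pow, hQn]
    calc _ ≤ Real.exp (-2 * Real.pi * z.im) ^ 2 * (ε * Real.exp (4 * Real.pi * -z.im)) := by gcongr
      _ = _ := by
        rw [show 4 * Real.pi * -z.im = -2 * Real.pi * z.im + -2 * Real.pi * z.im by ring,
          Real.exp_add]; ring
  have hz := eq_zero_of_isLittleO_pow_card {0, Q u, Q v, Q w} hd (by
      simp only [Finset.mem_insert, Finset.mem_singleton]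
      rintro z (rfl | rfl | rfl | rfl)
      · exact hΦ0
      all_goals simp only [Φ, hgQ, hu, hv, hw, mul_zero]) (by
      have : ({0, Q u, Q v, Q w} : Finset ℂ).card = 4 := by
        rw [Finset.card_insert_of_notMem, Finset.card_insert_of_notMem,
          Finset.card_insert_of_notMem, Finset.card_singleton]
        · simpa using hinj v w hvw
        · simpa using ⟨hinj u v huv, hinj u w huw⟩
        · simpa using ⟨(hQ0 u).symm, (hQ0 v).symm, (hQ0 w).symm⟩
      rw [this]; exact hlarge) (Q s)
  simp only [Φ, hgQ] at hz
  exact (mul_eq_zero.1 hz).resolve_left (pow_ne_zero 2 (hQ0 s))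

structure SmallPeriodic (f : ℂ → ℂ) : Prop where
  differentiable : Differentiable ℂ f
  periodic : Function.Periodic f 1
  growth : ∀ ε > 0, ∃ T : ℝ, ∀ s : ℂ, T ≤ |s.im| →
    ‖f s‖ ≤ ε * Real.exp (4 * Real.pi * |s.im|)

theorem BilatParams.smallPeriodic {x y : Fin 4 → ℂ} (h : BilatParams x y) :
    SmallPeriodic (bilatSum x y) :=
  ⟨h.differentiable, bilatSum_periodic x y, fun _ hε => h.growth hε⟩

theorem SmallPeriodic.sub {f g : ℂ → ℂ} (hf : SmallPeriodic f) (hg : SmallPeriodic g) :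
    SmallPeriodic (fun s => f s - g s) where
  differentiable := hf.differentiable.sub hg.differentiable
  periodic s := by simp only [hf.periodic s, hg.periodic s]
  growth ε hε := by
    obtain ⟨T, hT⟩ := hf.growth (ε / 2) (by positivity)
    obtain ⟨T', hT'⟩ := hg.growth (ε / 2) (by positivity)
    refine ⟨max T T', fun s hs => ?_⟩
    have h1 := hT s ((le_max_left _ _).trans hs)
    have h2 := hT' s ((le_max_right _ _).trans hs)
    have := norm_sub_le (f s) (g s)
    linarith

theorem smallPeriodic_Sn_mul_Sn (k y z : ℂ) :
    SmallPeriodic (fun s => k * (Sn (s + y) * Sn (s + z))) where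
  differentiable := by unfold Sn; fun_prop
  periodic s := by
    simp only [add_right_comm s 1, Sn_add_one, neg_mul_neg]
  growth ε hε := by
    set C := ‖k‖ * (Real.exp (Real.pi * |y.im|) * Real.exp (Real.pi * |z.im|))
    have hlim : Tendsto (fun t : ℝ => C * Real.exp (-(2 * Real.pi * t))) atTop (𝓝 0) := by
      have h := (Real.tendsto_exp_neg_atTop_nhds_zero.comp
        (tendsto_id.const_mul_atTop (by positivity : 0 < 2 * Real.pi))).const_mul C
      simpa using h
    obtain ⟨T, hT⟩ := eventually_atTop.1 (hlim.eventually (ge_mem_nhds hε))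
    refine ⟨T, fun s hs => ?_⟩
    have hS : ∀ w : ℂ, ‖Sn (s + w)‖ ≤ Real.exp (Real.pi * |w.im|) * Real.exp (Real.pi * |s.im|) :=
      fun w => by
        refine (norm_Sn_le _).trans ?_
        rw [← Real.exp_add]
        refine Real.exp_le_exp.2 ?_
        have := abs_add_le s.im w.im
        rw [add_im]
        nlinarith [Real.pi_pos]
    rw [norm_mul, norm_mul]
    calc _ ≤ ‖k‖ * ((Real.exp (Real.pi * |y.im|) * Real.exp (Real.pi * |s.im|)) *
          (Real.exp (Real.pi * |z.im|) * Real.exp (Real.pi * |s.im|))) := by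
          gcongr
          exacts [hS y, hS z]
      _ = C * Real.exp (-(2 * Real.pi * |s.im|)) * Real.exp (4 * Real.pi * |s.im|) := by
          rw [show 4 * Real.pi * |s.im| = 2 * Real.pi * |s.im| + Real.pi * |s.im| +
            Real.pi * |s.im| by ring, Real.exp_add, Real.exp_add, Real.exp_neg]
          field_simp
          simp only [C]
          ring
      _ ≤ _ := by
          gcongr
          exact hT _ hs

theorem Sn_zero : Sn 0 = 0 := by simp [Sn]

theorem SmallPeriodic.interpolate {f : ℂ → ℂ} (hf : SmallPeriodic f) {b c d : ℂ}
    (hcb : ∀ n : ℤ, c - b ≠ n) (hdb : ∀ n : ℤ, d - b ≠ n) (hdc : ∀ n : ℤ, d - c ≠ n) (s : ℂ) :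
    f s = f (-b) / (Sn (c - b) * Sn (d - b)) * (Sn (s + c) * Sn (s + d)) -
      f (-c) / (Sn (c - b) * Sn (d - c)) * (Sn (s + b) * Sn (s + d)) +
      f (-d) / (Sn (d - b) * Sn (d - c)) * (Sn (s + b) * Sn (s + c)) := by
  have h1 := Sn_ne_zero hcb
  have h2 := Sn_ne_zero hdb
  have h3 := Sn_ne_zero hdc
  have h := ((hf.sub (smallPeriodic_Sn_mul_Sn (f (-b) / (Sn (c - b) * Sn (d - b))) c d)).sub
    (smallPeriodic_Sn_mul_Sn (-(f (-c) / (Sn (c - b) * Sn (d - c)))) b d)).sub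
    (smallPeriodic_Sn_mul_Sn (f (-d) / (Sn (d - b) * Sn (d - c))) b c)
  have key := eq_zero_of_periodic h.differentiable h.periodic h.growth (u := -b) (v := -c)
    (w := -d) ?_ ?_ ?_ ?_ ?_ ?_ s
  · linear_combination key
  · simp only [neg_add_cancel, neg_add_eq_sub, Sn_zero]
    field_simp; ring
  · simp only [neg_add_cancel, neg_add_eq_sub, Sn_zero, Sn_sub_comm b c]
    field_simp; ring
  · simp only [neg_add_cancel, neg_add_eq_sub, Sn_zero, Sn_sub_comm b d, Sn_sub_comm c d]
    field_simp; ring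
  all_goals rw [neg_sub_neg]; assumption

theorem phi_add (x y z s : ℂ) : phi x y (z + s) = phi (x + z) (y + z) s := by
  rw [phi, phi]; ring_nf

theorem Sn_add_natCast (x : ℂ) (n : ℕ) : Sn (x + n) = (-1) ^ n * Sn x := by
  induction n with
  | zero => simp
  | succ n ih => rw [Nat.cast_succ, ← add_assoc, Sn_add_one, ih, pow_succ]; ring

theorem phi_natCast {x : ℂ} (hx : ∀ n : ℤ, x ≠ n) (y : ℂ) (n : ℕ) :
    phi x y n = (-1) ^ n * (Sn x / Real.pi) * (Gamma (n + x) / Gamma (n + y)) := by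
  have h := inv_Gamma_one_sub (x := x + n) (by exact_mod_cast not_int_add hx n)
  rw [phi, sub_sub, h, Sn_add_natCast, add_comm x, add_comm y]
  ring

theorem tsum_phi {p q r t : ℂ} (hp : ∀ n : ℤ, p ≠ n) (hq : ∀ n : ℤ, q ≠ n) (hr : ∀ n : ℤ, r ≠ n)
    (ht : ∀ n : ℤ, t ≠ n) (u v w : ℂ) :
    ∑' n : ℤ, phi p 1 n * phi q u n * phi r v n * phi t w n =
      Sn p * Sn q * Sn r * Sn t / Real.pi ^ 4 * Fstar p q r t u v w := by
  rw [Fstar, ← tsum_mul_left, ← (Nat.cast_injective (R := ℤ)).tsum_eq]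
  · refine tsum_congr fun n => ?_
    rw [Int.cast_natCast, phi_natCast hp, phi_natCast hq, phi_natCast hr, phi_natCast ht,
      Gamma_nat_eq_factorial]
    have h : ((-1 : ℂ) ^ n) * (-1) ^ n = 1 := by rw [← mul_pow]; simp
    linear_combination ((-1 : ℂ) ^ n * (-1) ^ n + 1) * (Sn p * Sn q * Sn r * Sn t / Real.pi ^ 4 *
      ((Gamma (n + p) * Gamma (n + q) * Gamma (n + r) * Gamma (n + t)) /
      (n.factorial * Gamma (n + u) * Gamma (n + v) * Gamma (n + w)))) * h
  · intro n hn
    cases n with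
    | ofNat m => exact ⟨m, rfl⟩
    | negSucc m =>
      exfalso
      apply hn
      have : Gamma (1 + (Int.negSucc m : ℤ)) = 0 := by
        rw [Int.cast_negSucc, Gamma_eq_zero_iff]
        exact ⟨m, by push_cast; ring⟩
      simp only [phi, this, inv_zero, mul_zero, zero_mul]

theorem bilatSum_neg (x y : Fin 4 → ℂ) (z : ℂ) :
    bilatSum x y (-z) = ∑' n : ℤ, ∏ i, phi (1 - y i + z) (1 - x i + z) n := by
  rw [bilatSum, ← (Equiv.neg ℤ).tsum_eq fun n : ℤ => bilatTerm x y (-z + n)]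
  refine tsum_congr fun n => ?_
  rw [Equiv.neg_apply, Int.cast_neg, ← neg_add, bilatTerm_neg]
  exact Finset.prod_congr rfl fun i _ => phi_add _ _ _ _

theorem bilatSum_zero_eval {a b c d : ℂ} (ha : ∀ n : ℤ, a ≠ n) (hb : ∀ n : ℤ, b ≠ n)
    (hc : ∀ n : ℤ, c ≠ n) (hd : ∀ n : ℤ, d ≠ n) (e f g : ℂ) :
    bilatSum ![b, a, c, d] ![1, e, f, g] 0 =
      Sn a * Sn b * Sn c * Sn d / Real.pi ^ 4 * Fstar a b c d e f g := by
  rw [Fstar_swap₁₂, mul_comm (Sn a), ← tsum_phi hb ha hc hd]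
  refine tsum_congr fun n => ?_
  simp [bilatTerm, Fin.prod_univ_four]

theorem bilatSum_neg_eval {a b c d e f g z : ℂ} (hz : ∀ n : ℤ, z ≠ n) (he : ∀ n : ℤ, e - z ≠ n)
    (hf : ∀ n : ℤ, f - z ≠ n) (hg : ∀ n : ℤ, g - z ≠ n) {u v w : ℂ}
    (h : ∀ n : ℤ, phi z (1 + z - b) n * phi (1 + z - e) (1 + z - a) n *
        phi (1 + z - f) (1 + z - c) n * phi (1 + z - g) (1 + z - d) n =
      phi z 1 n * phi (1 + z - e) u n * phi (1 + z - f) v n * phi (1 + z - g) w n) :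
    bilatSum ![b, a, c, d] ![1, e, f, g] (-z) =
      Sn z * Sn (e - z) * Sn (f - z) * Sn (g - z) / Real.pi ^ 4 *
        Fstar z (1 + z - e) (1 + z - f) (1 + z - g) u v w := by
  have h1 : ∀ {x : ℂ}, (∀ n : ℤ, x - z ≠ n) → ∀ n : ℤ, 1 + z - x ≠ n := fun hx => by
    rw [← sub_sub_eq_add_sub]
    exact not_int_one_sub hx
  have h2 : ∀ x : ℂ, Sn (x - z) = Sn (1 + z - x) := fun x => by
    rw [← Sn_one_sub]; ring_nf
  rw [bilatSum_neg, h2 e, h2 f, h2 g, ← tsum_phi hz (h1 he) (h1 hf) (h1 hg)]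
  refine tsum_congr fun n => ?_
  rw [← h, Fin.prod_univ_four]
  simp [add_sub_right_comm]

set_option maxHeartbeats 4000000 in
theorem trig_cancel {a b c d e f g : ℂ} (hs : e + f + g = a + b + c + d + 1) :
    Sn (d - c) * (Sn (c - a) * Sn (d - a) * Sn b + Sn (e - a) * Sn (f - a) * Sn (g - a)) *
        (Sn (e - b) * Sn (f - b) * Sn (g - b)) -
      Sn (d - b) * (Sn (b - a) * Sn (d - a) * Sn c + Sn (e - a) * Sn (f - a) * Sn (g - a)) *
        (Sn (e - c) * Sn (f - c) * Sn (g - c)) +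
      Sn (c - b) * (Sn (b - a) * Sn (c - a) * Sn d + Sn (e - a) * Sn (f - a) * Sn (g - a)) *
        (Sn (e - d) * Sn (f - d) * Sn (g - d)) = 0 := by
  obtain rfl : g = a + b + c + d + 1 - e - f := by linear_combination hs
  simp only [Sn_eq_expPi, expPi_add, expPi_sub, expPi_one]
  have h1 := expPi_ne_zero a
  have h2 := expPi_ne_zero b
  have h3 := expPi_ne_zero c
  have h4 := expPi_ne_zero d
  have h5 := expPi_ne_zero e
  have h6 := expPi_ne_zero f
  generalize expPi a = A at *
  generalize expPi b = B at *
  generalize expPi c = C at *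
  generalize expPi d = D at *
  generalize expPi e = E at *
  generalize expPi f = F at *
  field_simp
  ring

def orbit4Expr (a b c d e f g : ℂ) : ℂ :=
  Sn (d - c) * Af (1 - a) (e - a) (f - a) (g - a) * Af (1 - a) (1 - b) (1 - c) (1 - d) *
      Af b (1 + b - e) (1 + b - f) (1 + b - g) * Kf a b c d e f g -
    Af (1 - c) (e - c) (f - c) (g - c) * B1 a b d c e f g *
      Lf (1 - a) (e - a) (f - a) (g - a) (1 + d - a) (1 + c - a) (1 + b - a) +
    Af (1 - d) (e - d) (f - d) (g - d) * B1 a b c d e f g *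
      Lf (1 - a) (e - a) (f - a) (g - a) (1 + c - a) (1 + b - a) (1 + d - a)

structure GenericParams (a b c d e f g : ℂ) : Prop where
  sum : e + f + g = a + b + c + d + 1
  not_int : ∀ i : Fin 7, ∀ n : ℤ, ![a, b, c, d, e, f, g] i ≠ (n : ℂ)
  not_int_sub : ∀ i j : Fin 7, i ≠ j → ∀ n : ℤ,
    ![a, b, c, d, e, f, g] i - ![a, b, c, d, e, f, g] j ≠ (n : ℂ)

theorem not_int_one_add_sub {x y : ℂ} (h : ∀ n : ℤ, y - x ≠ n) : ∀ n : ℤ, 1 + x - y ≠ n := by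
  rw [← sub_sub_eq_add_sub]
  exact not_int_one_sub h

theorem Lf_eq {a b c d e f g : ℂ} (h : GenericParams a b c d e f g)
    (v0 : 0 < (1 + e - a - d).re) (v1 : (1 + e - a - d).re < 1)
    (v2 : 0 < (1 + c - a).re) (v3 : (1 + c - a).re < 1)
    (v4 : 0 < (1 + b - d).re) (v5 : (1 + b - d).re < 1)
    (v6 : 0 < (a + c - e).re) (v7 : (a + c - e).re < 1) :
    Lf (1 - a) (e - a) (f - a) (g - a) (1 + d - a) (1 + c - a) (1 + b - a) *
        (Gamma c * Gamma (1 + c - e) * Gamma (1 + c - f) * Gamma (1 + c - g) *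
          (Gamma b * Gamma (1 + b - e) * Gamma (1 + b - f) * Gamma (1 + b - g))) =
      (Fstar b (1 + b - e) (1 + b - f) (1 + b - g) (1 + b - c) (1 + b - d) (1 + b - a) -
        Fstar c (1 + c - e) (1 + c - f) (1 + c - g) (1 + c - b) (1 + c - d) (1 + c - a)) /
        Sn (c - b) := by
  obtain ⟨hs, hi, hd⟩ := h
  have h0 := hi 0
  have h1 := hi 1
  have h2 := hi 2
  have h3 := hi 3
  have h40 := hd 4 0 (by decide)
  have h50 := hd 5 0 (by decide)
  have h60 := hd 6 0 (by decide)
  have h41 := hd 4 1 (by decide)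
  have h51 := hd 5 1 (by decide)
  have h61 := hd 6 1 (by decide)
  have h42 := hd 4 2 (by decide)
  have h52 := hd 5 2 (by decide)
  have h62 := hd 6 2 (by decide)
  have h43 := hd 4 3 (by decide)
  have h53 := hd 5 3 (by decide)
  have h63 := hd 6 3 (by decide)
  have h30 := hd 3 0 (by decide)
  have h03 := hd 0 3 (by decide)
  have h65 := hd 6 5 (by decide)
  have h04 := hd 0 4 (by decide)
  have h21 := hd 2 1 (by decide)
  have h4 := hi 4
  simp only [Fin.isValue, Matrix.cons_val] at h0 h1 h2 h3 h40 h50 h60 h41 h51 h61 h42 h52 h62 h43 h53 h63 h30 h03 h65 h04 h21 h4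
  have hac := not_int_of_re v6 v7
  have r1 : ∀ x y : ℂ, 1 + x - a - (y - a) = 1 + x - y := fun x y => by ring
  have r2 : ∀ x : ℂ, 1 + x - a - (1 - a) = x := fun x => by ring
  have r3 : ∀ x y : ℂ, 1 + (1 + x - a) - (1 + y - a) = 1 + x - y := fun x y => by ring
  have r4 : ∀ x y : ℂ, 1 + (x - a) - (1 + y - a) = x - y := fun x y => by ring
  have key := Fstar_two_term (A := 1 - a) (B := e - a) (C := f - a) (D := g - a)
    (E := 1 + d - a) (F := 1 + c - a) (G := 1 + b - a) (by linear_combination -hs)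
    (not_int_one_sub h0) h40 h50 h60
  simp only [r2] at key
  simp only [r1, r3, r4] at key
  rw [sub_sub_sub_cancel_right, sub_sub_sub_cancel_right,
    show 1 - a + (e - a) - (1 + c - a) = -(a + c - e) by ring,
    show 1 + c - (1 + b) = c - b by ring,
    show 1 + (1 - a) + (e - a) - (1 + d - a) = 1 + e - a - d by ring] at key
  have he1 : ∀ n : ℤ, e - 1 ≠ n := by
    have := not_int_add h4 (-1)
    rwa [Int.cast_neg, Int.cast_one, ← sub_eq_add_neg] at this
  have h := key (not_int_one_sub h3) h43 h53 h63 h2 (not_int_one_add_sub h42)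
    (not_int_one_add_sub h52) (not_int_one_add_sub h62) h1 (not_int_one_add_sub h41)
    (not_int_one_add_sub h51) (not_int_one_add_sub h61) (not_int_one_add_sub h03) h65 he1
    (not_int_neg hac) h21 v0 v1 v2 v3 v4 v5
  have n1 := Gamma_ne_zero' (not_int_one_sub h0)
  have n2 := Gamma_ne_zero' h40
  have n3 := Gamma_ne_zero' h50
  have n4 := Gamma_ne_zero' h60
  have n5 := Gamma_ne_zero' (not_int_one_sub h3)
  have n6 := Gamma_ne_zero' h43
  have n7 := Gamma_ne_zero' h53
  have n8 := Gamma_ne_zero' h63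
  have hN : Gamma (1 - a) * Gamma (e - a) * Gamma (f - a) * Gamma (g - a) *
      (Gamma (1 - d) * Gamma (e - d) * Gamma (f - d) * Gamma (g - d)) ≠ 0 := by
    simp only [ne_eq, mul_eq_zero, not_or]
    exact ⟨⟨⟨⟨n1, n2⟩, n3⟩, n4⟩, ⟨⟨n5, n6⟩, n7⟩, n8⟩
  rw [← div_eq_iff hN] at h
  rw [← h, Lf, show 1 + (1 - a) - (1 + d - a) = 1 - d by ring]
  simp only [r3, r4, div_eq_mul_inv, mul_inv]
  ring

theorem GenericParams.swap {a b c d e f g : ℂ} (h : GenericParams a b c d e f g) :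
    GenericParams a b d c e f g := by
  have e : ![a, b, d, c, e, f, g] = ![a, b, c, d, e, f, g] ∘ Equiv.swap (2 : Fin 7) 3 := by
    ext i; fin_cases i <;> rfl
  refine ⟨by rw [h.sum]; ring, ?_, ?_⟩
  · rw [e]
    exact fun i => h.not_int _
  · rw [e]
    exact fun i j hij => h.not_int_sub _ _ ((Equiv.swap (2 : Fin 7) 3).injective.ne hij)

theorem inv_Gamma_sub {x y : ℂ} (h : ∀ n : ℤ, y - x ≠ n) :
    (Gamma (y - x))⁻¹ = Gamma (1 + x - y) * Sn (y - x) / Real.pi := by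
  have := inv_Gamma_one_sub (not_int_one_sub h)
  rwa [sub_sub_cancel, Sn_one_sub, sub_sub_eq_add_sub] at this

theorem Af_eq {x e f g : ℂ} (hx : ∀ n : ℤ, x ≠ n) (he : ∀ n : ℤ, e - x ≠ n)
    (hf : ∀ n : ℤ, f - x ≠ n) (hg : ∀ n : ℤ, g - x ≠ n) :
    Af (1 - x) (e - x) (f - x) (g - x) =
      Gamma x * Gamma (1 + x - e) * Gamma (1 + x - f) * Gamma (1 + x - g) *
        (Sn x * (Sn (e - x) * Sn (f - x) * Sn (g - x))) / Real.pi ^ 4 := by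
  rw [Af, one_div, mul_inv, mul_inv, mul_inv, inv_Gamma_one_sub hx, inv_Gamma_sub he,
    inv_Gamma_sub hf, inv_Gamma_sub hg]
  ring

theorem Lf_swap (a b c d e f g : ℂ) : Lf a b c d e f g = Lf a b c d e g f := by
  rw [Lf, Lf, Fstar_swap₆₇, Fstar_swap₆₇ (1 + a - e)]

theorem orbit4_region {a b c d e f g : ℂ} (h : GenericParams a b c d e f g)
    (hP : BilatParams ![b, a, c, d] ![1, e, f, g])
    (v0 : 0 < (1 + e - a - d).re) (v1 : (1 + e - a - d).re < 1)
    (v2 : 0 < (1 + c - a).re) (v3 : (1 + c - a).re < 1)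
    (v4 : 0 < (1 + b - d).re) (v5 : (1 + b - d).re < 1)
    (v6 : 0 < (a + c - e).re) (v7 : (a + c - e).re < 1)
    (w0 : 0 < (1 + e - a - c).re) (w1 : (1 + e - a - c).re < 1)
    (w2 : 0 < (1 + d - a).re) (w3 : (1 + d - a).re < 1)
    (w4 : 0 < (1 + b - c).re) (w5 : (1 + b - c).re < 1)
    (w6 : 0 < (a + d - e).re) (w7 : (a + d - e).re < 1) :
    orbit4Expr a b c d e f g = 0 := by
  have L1 := Lf_eq h v0 v1 v2 v3 v4 v5 v6 v7
  have L2 := Lf_eq h.swap w0 w1 w2 w3 w4 w5 w6 w7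
  obtain ⟨hs, hi, hd⟩ := h
  have h0 := hi 0
  have h1 := hi 1
  have h2 := hi 2
  have h3 := hi 3
  have h40 := hd 4 0 (by decide)
  have h50 := hd 5 0 (by decide)
  have h60 := hd 6 0 (by decide)
  have h41 := hd 4 1 (by decide)
  have h51 := hd 5 1 (by decide)
  have h61 := hd 6 1 (by decide)
  have h42 := hd 4 2 (by decide)
  have h52 := hd 5 2 (by decide)
  have h62 := hd 6 2 (by decide)
  have h43 := hd 4 3 (by decide)
  have h53 := hd 5 3 (by decide)
  have h63 := hd 6 3 (by decide)
  have h21 := hd 2 1 (by decide)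
  have h31 := hd 3 1 (by decide)
  have h32 := hd 3 2 (by decide)
  simp only [Fin.isValue, Matrix.cons_val] at h0 h1 h2 h3 h40 h50 h60 h41 h51 h61 h42 h52 h62 h43 h53 h63 h21 h31 h32
  have hF := hP.smallPeriodic
  have r0 := hF.interpolate h21 h31 h32 0
  have ra := hF.interpolate h21 h31 h32 (-a)
  rw [bilatSum_zero_eval h0 h1 h2 h3] at r0
  rw [bilatSum_neg_eval h0 h40 h50 h60 (u := 1 + a - b) (v := 1 + a - c) (w := 1 + a - d)
    (fun n => by simp only [phi, add_sub_cancel_right]; ring)] at ra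
  have eb := bilatSum_neg_eval (a := a) (b := b) (c := c) (d := d) h1 h41 h51 h61 (u := 1 + b - c)
    (v := 1 + b - d) (w := 1 + b - a) (fun n => by simp only [phi, add_sub_cancel_right]; ring)
  have ec := bilatSum_neg_eval (a := a) (b := b) (c := c) (d := d) h2 h42 h52 h62 (u := 1 + c - b)
    (v := 1 + c - d) (w := 1 + c - a) (fun n => by simp only [phi, add_sub_cancel_right]; ring)
  have ed := bilatSum_neg_eval (a := a) (b := b) (c := c) (d := d) h3 h43 h53 h63 (u := 1 + d - b)
    (v := 1 + d - c) (w := 1 + d - a) (fun n => by simp only [phi, add_sub_cancel_right]; ring)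
  rw [eb, ec, ed] at r0 ra
  rw [Fstar_swap₅₆ b _ _ _ (1 + b - d), Lf_swap] at L2
  simp only [zero_add, neg_add_eq_sub] at r0 ra
  have s0 := Sn_ne_zero h0
  have s1 := Sn_ne_zero h21
  have s2 := Sn_ne_zero h31
  have s3 := Sn_ne_zero h32
  have trig := trig_cancel hs
  have hpi := pi_ne_zero'
  have ga := Gamma_ne_zero' h0
  have gb := Gamma_ne_zero' h1
  have gc := Gamma_ne_zero' h2
  have gd := Gamma_ne_zero' h3
  have ga1 := Gamma_ne_zero' (not_int_one_add_sub h40)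
  have ga2 := Gamma_ne_zero' (not_int_one_add_sub h50)
  have ga3 := Gamma_ne_zero' (not_int_one_add_sub h60)
  have gb1 := Gamma_ne_zero' (not_int_one_add_sub h41)
  have gb2 := Gamma_ne_zero' (not_int_one_add_sub h51)
  have gb3 := Gamma_ne_zero' (not_int_one_add_sub h61)
  have gc1 := Gamma_ne_zero' (not_int_one_add_sub h42)
  have gc2 := Gamma_ne_zero' (not_int_one_add_sub h52)
  have gc3 := Gamma_ne_zero' (not_int_one_add_sub h62)
  have gd1 := Gamma_ne_zero' (not_int_one_add_sub h43)
  have gd2 := Gamma_ne_zero' (not_int_one_add_sub h53)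
  have gd3 := Gamma_ne_zero' (not_int_one_add_sub h63)
  have A2 : Af (1 - a) (1 - b) (1 - c) (1 - d) =
      Gamma a * Gamma b * Gamma c * Gamma d * (Sn a * Sn b * Sn c * Sn d) / Real.pi ^ 4 := by
    rw [Af, one_div, mul_inv, mul_inv, mul_inv, inv_Gamma_one_sub h0, inv_Gamma_one_sub h1,
      inv_Gamma_one_sub h2, inv_Gamma_one_sub h3]
    ring
  rw [orbit4Expr, Af_eq h0 h40 h50 h60, A2, Af_eq h2 h42 h52 h62, Af_eq h3 h43 h53 h63, Kf, B1, B1,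
    Af]
  generalize Lf (1 - a) (e - a) (f - a) (g - a) (1 + d - a) (1 + c - a) (1 + b - a) = X1 at *
  generalize Lf (1 - a) (e - a) (f - a) (g - a) (1 + c - a) (1 + b - a) (1 + d - a) = X2 at *
  generalize Fstar a b c d e f g = F0 at *
  generalize Fstar a (1 + a - e) (1 + a - f) (1 + a - g) (1 + a - b) (1 + a - c) (1 + a - d) = Fa at *
  generalize Fstar b (1 + b - e) (1 + b - f) (1 + b - g) (1 + b - c) (1 + b - d) (1 + b - a) = Fb at *
  generalize Fstar c (1 + c - e) (1 + c - f) (1 + c - g) (1 + c - b) (1 + c - d) (1 + c - a) = Fc at *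
  generalize Fstar d (1 + d - e) (1 + d - f) (1 + d - g) (1 + d - b) (1 + d - c) (1 + d - a) = Fd at *
  clear hP hF eb ec ed hi hd h0 h1 h2 h3 h40 h50 h60 h41 h51 h61 h42 h52 h62 h43 h53 h63 h21 h31 h32
  clear A2 v0 v1 v2 v3 v4 v5 v6 v7 w0 w1 w2 w3 w4 w5 w6 w7 hs
  have T1 : Sn (d - c) * (Gamma a * Gamma (1 + a - e) * Gamma (1 + a - f) * Gamma (1 + a - g) *
        (Sn a * (Sn (e - a) * Sn (f - a) * Sn (g - a))) / Real.pi ^ 4) *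
      (Gamma a * Gamma b * Gamma c * Gamma d * (Sn a * Sn b * Sn c * Sn d) / Real.pi ^ 4) *
      (1 / (Gamma b * Gamma (1 + b - e) * Gamma (1 + b - f) * Gamma (1 + b - g))) *
      ((F0 + Fa) / (Sn a * Gamma a ^ 2 * Gamma b * Gamma c * Gamma d * Gamma (1 + a - e) *
        Gamma (1 + a - f) * Gamma (1 + a - g))) =
      Sn (d - c) * (Sn (e - a) * Sn (f - a) * Sn (g - a)) * (Sn a * Sn b * Sn c * Sn d) *
      (F0 + Fa) / Real.pi ^ 8 /
      (Gamma b * Gamma (1 + b - e) * Gamma (1 + b - f) * Gamma (1 + b - g)) := by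
    field_simp
  have gB : Gamma b * Gamma (1 + b - e) * Gamma (1 + b - f) * Gamma (1 + b - g) ≠ 0 :=
    mul_ne_zero (mul_ne_zero (mul_ne_zero gb gb1) gb2) gb3
  rw [T1]
  clear T1 ga gb gc gd ga1 ga2 ga3 gb1 gb2 gb3 gc1 gc2 gc3 gd1 gd2 gd3
  rw [← mul_assoc X1, ← eq_div_iff gB] at L1
  rw [← mul_assoc X2, ← eq_div_iff gB] at L2
  generalize Gamma b * Gamma (1 + b - e) * Gamma (1 + b - f) * Gamma (1 + b - g) = GB at *
  generalize Gamma c * Gamma (1 + c - e) * Gamma (1 + c - f) * Gamma (1 + c - g) = GC at *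
  generalize Gamma d * Gamma (1 + d - e) * Gamma (1 + d - f) * Gamma (1 + d - g) = GD at *
  simp only [mul_assoc (Sn a) (Sn (e - a)), mul_assoc (Sn b) (Sn (e - b)),
    mul_assoc (Sn c) (Sn (e - c)), mul_assoc (Sn d) (Sn (e - d)),
    mul_assoc (Sn a) (_ * Sn (f - a)), mul_assoc (Sn b) (_ * Sn (f - b)),
    mul_assoc (Sn c) (_ * Sn (f - c)), mul_assoc (Sn d) (_ * Sn (f - d))] at r0 ra
  generalize Sn (e - a) * Sn (f - a) * Sn (g - a) = Pa at *
  generalize Sn (e - b) * Sn (f - b) * Sn (g - b) = Pb at *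
  generalize Sn (e - c) * Sn (f - c) * Sn (g - c) = Pc at *
  generalize Sn (e - d) * Sn (f - d) * Sn (g - d) = Pd at *
  generalize (Real.pi : ℂ) = p at *
  generalize Sn a = sa at *
  generalize Sn b = sb at *
  generalize Sn c = sc at *
  generalize Sn d = sd at *
  generalize Sn (c - b) = k1 at *
  generalize Sn (d - b) = k2 at *
  generalize Sn (d - c) = k3 at *
  generalize Sn (b - a) = t1 at *
  generalize Sn (c - a) = t2 at *
  generalize Sn (d - a) = t3 at *
  have e1 : GC * (sc * Pc) / p ^ 4 * (sb * sd * (t1 * t3 * sc + Pa) / p ^ 4) * X1 =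
      sc * Pc * (sb * sd * (t1 * t3 * sc + Pa)) * (X1 * GC) / p ^ 8 := by ring
  have e2 : GD * (sd * Pd) / p ^ 4 * (sb * sc * (t1 * t2 * sd + Pa) / p ^ 4) * X2 =
      sd * Pd * (sb * sc * (t1 * t2 * sd + Pa)) * (X2 * GD) / p ^ 8 := by ring
  rw [e1, e2, L1, L2]
  clear L1 L2 e1 e2
  field_simp at r0 ra ⊢
  linear_combination Pa * r0 + sb * sc * sd * ra + sb * sc * sd * Fb * trig

theorem not_int_of_Sn_ne_zero {x : ℂ} (hx : Sn x ≠ 0) : ∀ n : ℤ, x ≠ n := by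
  rintro n rfl
  exact hx (by rw [Sn, mul_comm]; exact Complex.sin_int_mul_pi n)

theorem differentiable_Sn : Differentiable ℂ Sn := by
  unfold Sn
  fun_prop

theorem eventually_not_int {u : ℂ → ℂ} {z : ℂ} (hu : ContinuousAt u z) (h : ∀ n : ℤ, u z ≠ n) :
    ∀ᶠ w in 𝓝 z, ∀ n : ℤ, u w ≠ n :=
  ((differentiable_Sn.continuous.continuousAt.comp hu).eventually_ne (Sn_ne_zero h)).mono
    fun _ hw => not_int_of_Sn_ne_zero hw

/-- The general term of the series `Fstar`. -/
def FstarTerm (a b c d e f g : ℂ) (k : ℕ) : ℂ :=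
  (Gamma (k + a) * Gamma (k + b) * Gamma (k + c) * Gamma (k + d)) /
    ((k.factorial : ℂ) * Gamma (k + e) * Gamma (k + f) * Gamma (k + g))

theorem FstarTerm_succ {a b c d e f g : ℂ} (ha : ∀ n : ℤ, a ≠ n) (hb : ∀ n : ℤ, b ≠ n)
    (hc : ∀ n : ℤ, c ≠ n) (hd : ∀ n : ℤ, d ≠ n) (he : ∀ n : ℤ, e ≠ n) (hf : ∀ n : ℤ, f ≠ n)
    (hg : ∀ n : ℤ, g ≠ n) (k : ℕ) :
    FstarTerm a b c d e f g (k + 1) = FstarTerm a b c d e f g k *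
      ((k + a) * (k + b) * (k + c) * (k + d) / ((k + 1) * (k + e) * (k + f) * (k + g))) := by
  have key : ∀ x : ℂ, (∀ n : ℤ, x ≠ n) →
      Gamma (k + 1 + x) = (k + x) * Gamma (k + x) ∧ (k : ℂ) + x ≠ 0 := by
    intro x hx
    have h0 : (k : ℂ) + x ≠ 0 := fun h => hx (-k) (by push_cast; linear_combination h)
    refine ⟨?_, h0⟩
    rw [← Gamma_add_one _ h0, add_right_comm]
  have hk : (k : ℂ) + 1 ≠ 0 := by exact_mod_cast k.succ_ne_zero
  have hG : ∀ x : ℂ, (∀ n : ℤ, x ≠ n) → Gamma (k + x) ≠ 0 := fun x hx =>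
    Gamma_ne_zero' (by rw [add_comm]; exact_mod_cast not_int_add hx k)
  have hkf : (k.factorial : ℂ) ≠ 0 := by exact_mod_cast k.factorial_ne_zero
  have := hG e he
  have := hG f hf
  have := hG g hg
  have := (key e he).2
  have := (key f hf).2
  have := (key g hg).2
  simp only [FstarTerm, Nat.factorial_succ, Nat.cast_mul, Nat.cast_add, Nat.cast_one,
    (key a ha).1, (key b hb).1, (key c hc).1, (key d hd).1, (key e he).1, (key f hf).1,
    (key g hg).1]
  field_simp

theorem le_of_ratio_le {u : ℕ → ℝ} {C : ℝ} {K : ℕ} (hK : 1 ≤ K) (hu : ∀ k, 0 ≤ u k)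
    (hC : 0 ≤ C)
    (h : ∀ k ≥ K, u (k + 1) ≤ (1 + C / (k : ℝ) ^ 2) * u k) :
    ∀ k ≥ K, u k ≤ u K * Real.exp (2 * C) := by
  have anti : ∀ k ≥ K, u k * Real.exp (2 * C / k) ≤ u K * Real.exp (2 * C / K) := by
    intro k hk
    induction k, hk using Nat.le_induction with
    | base => rfl
    | succ k hk ih =>
      refine le_trans ?_ ih
      have hk1 : (1 : ℝ) ≤ k := by exact_mod_cast hK.trans hk
      calc u (k + 1) * Real.exp (2 * C / (k + 1 : ℕ))
          ≤ (Real.exp (C / (k : ℝ) ^ 2) * u k) * Real.exp (2 * C / (k + 1 : ℕ)) := by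
            gcongr
            refine (h k hk).trans ?_
            gcongr
            · exact hu k
            · rw [add_comm]; exact Real.add_one_le_exp _
        _ = u k * Real.exp (C / (k : ℝ) ^ 2 + 2 * C / (k + 1 : ℕ)) := by
            rw [Real.exp_add]; ring
        _ ≤ u k * Real.exp (2 * C / k) := by
            refine mul_le_mul_of_nonneg_left (Real.exp_le_exp.2 ?_) (hu k)
            have : 2 * C / k - (C / (k : ℝ) ^ 2 + 2 * C / (k + 1 : ℕ)) =
                C * (k - 1) / ((k : ℝ) ^ 2 * (k + 1)) := by
              push_cast
              field_simp
              ring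
            have h2 : 0 ≤ C * (k - 1) / ((k : ℝ) ^ 2 * (k + 1)) := by
              have : (0 : ℝ) ≤ k - 1 := by linarith
              positivity
            linarith
  intro k hk
  have hK1 : (1 : ℝ) ≤ K := by exact_mod_cast hK
  calc u k ≤ u k * Real.exp (2 * C / k) :=
        le_mul_of_one_le_right (hu k) (Real.one_le_exp (by positivity))
    _ ≤ _ := anti k hk
    _ ≤ _ := by
      refine mul_le_mul_of_nonneg_left (Real.exp_le_exp.2 ?_) (hu K)
      exact div_le_self (by positivity) hK1

/-- A constant controlling the ratio of consecutive terms of `Fstar`. -/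
def FstarBound (a b c d e f g : ℂ) : ℝ :=
  let s1 := a + b + c + d
  let s2 := a * b + a * c + a * d + b * c + b * d + c * d
  let s3 := a * b * c + a * b * d + a * c * d + b * c * d
  let s4 := a * b * c * d
  let t1 := e + f + g
  let t2 := e * f + e * g + f * g
  let t3 := e * f * g
  ‖s2 + 4 * s1 + 4 - (t2 + 3 * t1 + 3)‖ + ‖s3 + 4 * s2 + 4 * s1 - (t3 + 3 * t2 + 3 * t1 + 1)‖ +
    ‖s4 + 4 * s3 + 4 * s2 - (3 * t3 + 3 * t2 + t1)‖ + ‖4 * s4 + 4 * s3 - (3 * t3 + t2)‖ +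
    ‖4 * s4 - t3‖

theorem norm_quartic_le (q4 q3 q2 q1 q0 : ℂ) {k : ℝ} (hk : 1 ≤ k) :
    ‖q4 * k ^ 4 + q3 * k ^ 3 + q2 * k ^ 2 + q1 * k + q0‖ ≤
      (‖q4‖ + ‖q3‖ + ‖q2‖ + ‖q1‖ + ‖q0‖) * k ^ 4 := by
  have h0 : 0 ≤ k := by linarith
  have hn : ∀ (q : ℂ) (m : ℕ), m ≤ 4 → ‖q * (k : ℂ) ^ m‖ ≤ ‖q‖ * k ^ 4 := by
    intro q m hm
    rw [norm_mul, norm_pow, norm_real, Real.norm_of_nonneg h0]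
    gcongr
  have h4 := hn q4 4 le_rfl
  have h3 := hn q3 3 (by norm_num)
  have h2 := hn q2 2 (by norm_num)
  have h1 := hn q1 1 (by norm_num)
  have h0 := hn q0 0 (by norm_num)
  rw [pow_one] at h1
  rw [pow_zero, mul_one] at h0
  calc _ ≤ ‖q4 * (k : ℂ) ^ 4‖ + ‖q3 * (k : ℂ) ^ 3‖ + ‖q2 * (k : ℂ) ^ 2‖ + ‖q1 * (k : ℂ)‖ + ‖q0‖ :=
        norm_add_le_of_le (norm_add_le_of_le (norm_add_le_of_le (norm_add_le _ _) le_rfl) le_rfl)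
          le_rfl
    _ ≤ _ := by linarith

theorem norm_ratio_le {a b c d e f g : ℂ} (h : e + f + g = a + b + c + d + 1) {k : ℝ}
    (hk : 1 ≤ k) (he : ‖e‖ ≤ k / 2) (hf : ‖f‖ ≤ k / 2) (hg : ‖g‖ ≤ k / 2) :
    ‖(k + a) * (k + b) * (k + c) * (k + d) / ((k + 1) * (k + e) * (k + f) * (k + g))‖ *
        (k + 2) ^ 2 ≤
      (1 + 8 * FstarBound a b c d e f g / k ^ 2) * (k + 1) ^ 2 := by
  have h0 : 0 < k := by linarith
  have low : ∀ x : ℂ, ‖x‖ ≤ k / 2 → k / 2 ≤ ‖k + x‖ := by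
    intro x hx
    have := norm_sub_le (k + x) x
    rw [add_sub_cancel_right, norm_real, Real.norm_of_nonneg h0.le] at this
    linarith
  have hk1 : ‖(k : ℂ) + 1‖ = k + 1 := by
    rw [← ofReal_one, ← ofReal_add, norm_real, Real.norm_of_nonneg (by linarith)]
  have hk2 : ‖(k : ℂ) + 2‖ = k + 2 := by
    rw [← ofReal_ofNat, ← ofReal_add, norm_real, Real.norm_of_nonneg (by linarith)]
  set Q := ‖(k : ℂ) + e‖ * ‖(k : ℂ) + f‖ * ‖(k : ℂ) + g‖ with hQ
  have hQ8 : k ^ 3 / 8 ≤ Q := by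
    calc k ^ 3 / 8 = k / 2 * (k / 2) * (k / 2) := by ring
      _ ≤ Q := by
        rw [hQ]
        exact mul_le_mul (mul_le_mul (low e he) (low f hf) (by positivity) (by positivity))
          (low g hg) (by positivity) (by positivity)
  have hQ0 : 0 < Q := lt_of_lt_of_le (by positivity) hQ8
  have hB : 0 ≤ FstarBound a b c d e f g := by
    unfold FstarBound
    positivity
  have main : ‖(k + a) * (k + b) * (k + c) * (k + d) * (k + 2) ^ 2‖ ≤
      (k + 1) ^ 3 * Q + FstarBound a b c d e f g * k ^ 4 := by
    have e1 : (k + a) * (k + b) * (k + c) * (k + d) * ((k : ℂ) + 2) ^ 2 =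
        (k + 1) ^ 3 * ((k + e) * (k + f) * (k + g)) +
        ((a * b + a * c + a * d + b * c + b * d + c * d + 4 * (a + b + c + d) + 4 -
            (e * f + e * g + f * g + 3 * (e + f + g) + 3)) * (k : ℂ) ^ 4 +
          (a * b * c + a * b * d + a * c * d + b * c * d +
            4 * (a * b + a * c + a * d + b * c + b * d + c * d) + 4 * (a + b + c + d) -
            (e * f * g + 3 * (e * f + e * g + f * g) + 3 * (e + f + g) + 1)) * (k : ℂ) ^ 3 +
          (a * b * c * d + 4 * (a * b * c + a * b * d + a * c * d + b * c * d) +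
            4 * (a * b + a * c + a * d + b * c + b * d + c * d) -
            (3 * (e * f * g) + 3 * (e * f + e * g + f * g) + (e + f + g))) * (k : ℂ) ^ 2 +
          (4 * (a * b * c * d) + 4 * (a * b * c + a * b * d + a * c * d + b * c * d) -
            (3 * (e * f * g) + (e * f + e * g + f * g))) * (k : ℂ) +
          (4 * (a * b * c * d) - e * f * g)) := by
      linear_combination (-(k : ℂ) ^ 5) * h
    rw [e1]
    refine norm_add_le_of_le (le_of_eq ?_) (norm_quartic_le _ _ _ _ _ hk)
    simp only [norm_mul, norm_pow, hk1, hQ]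
  rw [norm_mul, norm_pow, hk2] at main
  rw [norm_div, norm_mul _ ((k : ℂ) + g), norm_mul _ ((k : ℂ) + f), norm_mul _ ((k : ℂ) + e), hk1,
    mul_assoc (k + 1), mul_assoc (k + 1), ← hQ, div_mul_eq_mul_div, div_le_iff₀ (by positivity)]
  refine main.trans ?_
  have : FstarBound a b c d e f g * k ^ 4 ≤
      8 * FstarBound a b c d e f g / k ^ 2 * (k + 1) ^ 3 * Q := by
    calc FstarBound a b c d e f g * k ^ 4
        = 8 * FstarBound a b c d e f g / k ^ 2 * k ^ 3 * (k ^ 3 / 8) := by field_simp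
      _ ≤ _ := by
        gcongr
        linarith
  linarith

theorem norm_FstarTerm_le {a b c d e f g : ℂ} (h : e + f + g = a + b + c + d + 1)
    (ha : ∀ n : ℤ, a ≠ n) (hb : ∀ n : ℤ, b ≠ n)
    (hc : ∀ n : ℤ, c ≠ n) (hd : ∀ n : ℤ, d ≠ n) (he : ∀ n : ℤ, e ≠ n) (hf : ∀ n : ℤ, f ≠ n)
    (hg : ∀ n : ℤ, g ≠ n) {K : ℕ} (hK : 1 ≤ K) (heK : ‖e‖ ≤ (K : ℝ) / 2)
    (hfK : ‖f‖ ≤ (K : ℝ) / 2) (hgK : ‖g‖ ≤ (K : ℝ) / 2) {B : ℝ}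
    (hB : FstarBound a b c d e f g ≤ B) (k : ℕ) (hk : K ≤ k) :
    ‖FstarTerm a b c d e f g k‖ * ((k : ℝ) + 1) ^ 2 ≤
      ‖FstarTerm a b c d e f g K‖ * ((K : ℝ) + 1) ^ 2 * Real.exp (2 * (8 * B)) := by
  have hB0 : 0 ≤ B := le_trans (by unfold FstarBound; positivity) hB
  refine le_of_ratio_le (u := fun k => ‖FstarTerm a b c d e f g k‖ * ((k : ℝ) + 1) ^ 2)
    hK (fun k => by positivity) (by positivity) ?_ k hk
  intro k hk
  have hkK : (K : ℝ) ≤ k := by exact_mod_cast hk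
  have hk1 : (1 : ℝ) ≤ k := by exact_mod_cast hK.trans hk
  have := norm_ratio_le h hk1 (heK.trans (by linarith)) (hfK.trans (by linarith))
    (hgK.trans (by linarith))
  simp only [FstarTerm_succ ha hb hc hd he hf hg, norm_mul _ (_ / _)]
  rw [ofReal_natCast] at this
  push_cast
  rw [add_assoc (k : ℝ) 1 1, one_add_one_eq_two, mul_assoc]
  calc _ ≤ ‖FstarTerm a b c d e f g k‖ *
        ((1 + 8 * FstarBound a b c d e f g / (k : ℝ) ^ 2) * ((k : ℝ) + 1) ^ 2) := by gcongr
    _ ≤ ‖FstarTerm a b c d e f g k‖ * ((1 + 8 * B / (k : ℝ) ^ 2) * ((k : ℝ) + 1) ^ 2) := by gcongr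
    _ = _ := by ring

theorem DifferentiableAt.Gamma_of_not_int {u : ℂ → ℂ} {z : ℂ} (hu : DifferentiableAt ℂ u z)
    (h : ∀ n : ℤ, u z ≠ n) : DifferentiableAt ℂ (fun w => Gamma (u w)) z :=
  (differentiableAt_Gamma (u z) fun m hm => h (-m) (by push_cast; exact hm)).comp z hu

theorem not_int_nat_add {x : ℂ} (hx : ∀ n : ℤ, x ≠ n) (k : ℕ) : ∀ n : ℤ, (k : ℂ) + x ≠ n := by
  rw [add_comm]
  exact_mod_cast not_int_add hx k

theorem differentiableAt_FstarTerm {a b c d e f g : ℂ → ℂ} {z : ℂ} (ha : DifferentiableAt ℂ a z)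
    (hb : DifferentiableAt ℂ b z) (hc : DifferentiableAt ℂ c z) (hd : DifferentiableAt ℂ d z)
    (he : DifferentiableAt ℂ e z) (hf : DifferentiableAt ℂ f z) (hg : DifferentiableAt ℂ g z)
    (ia : ∀ n : ℤ, a z ≠ n) (ib : ∀ n : ℤ, b z ≠ n) (ic : ∀ n : ℤ, c z ≠ n)
    (id : ∀ n : ℤ, d z ≠ n) (ie : ∀ n : ℤ, e z ≠ n) (jf : ∀ n : ℤ, f z ≠ n)
    (ig : ∀ n : ℤ, g z ≠ n) (k : ℕ) :
    DifferentiableAt ℂ (fun w => FstarTerm (a w) (b w) (c w) (d w) (e w) (f w) (g w) k) z := by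
  have key : ∀ u : ℂ → ℂ, DifferentiableAt ℂ u z → (∀ n : ℤ, u z ≠ n) →
      DifferentiableAt ℂ (fun w => Gamma (k + u w)) z := fun u hu h =>
    (hu.const_add (k : ℂ)).Gamma_of_not_int (not_int_nat_add h k)
  have hk : (k.factorial : ℂ) ≠ 0 := by exact_mod_cast k.factorial_ne_zero
  have hG : ∀ x : ℂ, (∀ n : ℤ, x ≠ n) → Gamma (k + x) ≠ 0 := fun x hx =>
    Gamma_ne_zero' (not_int_nat_add hx k)
  refine DifferentiableAt.div ((((key a ha ia).mul (key b hb ib)).mul (key c hc ic)).mul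
    (key d hd id)) ((((key e he ie).const_mul _).mul (key f hf jf)).mul (key g hg ig)) ?_
  exact mul_ne_zero (mul_ne_zero (mul_ne_zero hk (hG _ ie)) (hG _ jf)) (hG _ ig)

theorem differentiableAt_Fstar {a b c d e f g : ℂ → ℂ} {z : ℂ} (ha : Differentiable ℂ a)
    (hb : Differentiable ℂ b) (hc : Differentiable ℂ c) (hd : Differentiable ℂ d)
    (he : Differentiable ℂ e) (hf : Differentiable ℂ f) (hg : Differentiable ℂ g)
    (hs : ∀ w, e w + f w + g w = a w + b w + c w + d w + 1)
    (ia : ∀ n : ℤ, a z ≠ n) (ib : ∀ n : ℤ, b z ≠ n) (ic : ∀ n : ℤ, c z ≠ n)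
    (id : ∀ n : ℤ, d z ≠ n) (ie : ∀ n : ℤ, e z ≠ n) (jf : ∀ n : ℤ, f z ≠ n)
    (ig : ∀ n : ℤ, g z ≠ n) :
    DifferentiableAt ℂ (fun w => Fstar (a w) (b w) (c w) (d w) (e w) (f w) (g w)) z := by
  have hca := ha.continuous
  have hcb := hb.continuous
  have hcc := hc.continuous
  have hcd := hd.continuous
  have hce := he.continuous
  have hcf := hf.continuous
  have hcg := hg.continuous
  obtain ⟨K, hK⟩ := exists_nat_ge (2 * (‖e z‖ + ‖f z‖ + ‖g z‖ + 1))
  have hK1 : 1 ≤ K := by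
    have : (1 : ℝ) ≤ K := by linarith [norm_nonneg (e z), norm_nonneg (f z), norm_nonneg (g z)]
    exact_mod_cast this
  have hBc : Continuous fun w => FstarBound (a w) (b w) (c w) (d w) (e w) (f w) (g w) := by
    unfold FstarBound
    fun_prop
  set B := FstarBound (a z) (b z) (c z) (d z) (e z) (f z) (g z) + 1 with hB
  set T : ℂ → ℕ → ℂ := fun w => FstarTerm (a w) (b w) (c w) (d w) (e w) (f w) (g w) with hT
  have hev : ∀ᶠ w in 𝓝 z, ((∀ n : ℤ, a w ≠ n) ∧ (∀ n : ℤ, b w ≠ n) ∧ (∀ n : ℤ, c w ≠ n) ∧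
      (∀ n : ℤ, d w ≠ n) ∧ (∀ n : ℤ, e w ≠ n) ∧ (∀ n : ℤ, f w ≠ n) ∧ (∀ n : ℤ, g w ≠ n)) ∧
      (‖e w‖ ≤ (K : ℝ) / 2 ∧ ‖f w‖ ≤ (K : ℝ) / 2 ∧ ‖g w‖ ≤ (K : ℝ) / 2) ∧
      FstarBound (a w) (b w) (c w) (d w) (e w) (f w) (g w) ≤ B ∧
      ∀ k ∈ Finset.range (K + 1), ‖T w k‖ ≤ ‖T z k‖ + 1 := by
    have hn : ∀ u : ℂ → ℂ, Continuous u → ‖u z‖ < (K : ℝ) / 2 →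
        ∀ᶠ w in 𝓝 z, ‖u w‖ ≤ (K : ℝ) / 2 := fun u hu h =>
      (hu.norm.continuousAt.eventually_lt continuousAt_const h).mono fun _ => le_of_lt
    refine (((eventually_not_int hca.continuousAt ia).and
      ((eventually_not_int hcb.continuousAt ib).and ((eventually_not_int hcc.continuousAt ic).and
      ((eventually_not_int hcd.continuousAt id).and ((eventually_not_int hce.continuousAt ie).and
      ((eventually_not_int hcf.continuousAt jf).and
      (eventually_not_int hcg.continuousAt ig)))))))).and
      (((hn e hce ?_).and ((hn f hcf ?_).and (hn g hcg ?_))).and (Eventually.and ?_ ?_))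
    · linarith [norm_nonneg (e z), norm_nonneg (f z), norm_nonneg (g z)]
    · linarith [norm_nonneg (e z), norm_nonneg (f z), norm_nonneg (g z)]
    · linarith [norm_nonneg (e z), norm_nonneg (f z), norm_nonneg (g z)]
    · exact (hBc.continuousAt.eventually_lt continuousAt_const (by linarith)).mono
        fun _ => le_of_lt
    · rw [Filter.eventually_all_finset]
      intro k _
      exact (((differentiableAt_FstarTerm (ha z) (hb z) (hc z) (hd z) (he z) (hf z) (hg z)
        ia ib ic id ie jf ig k).continuousAt.norm).eventually_lt continuousAt_const
        (lt_add_one _)).mono fun _ => le_of_lt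
  obtain ⟨U, hU, hUo, hzU⟩ := eventually_nhds_iff.1 hev
  set M := ∑ k ∈ Finset.range (K + 1), (‖T z k‖ + 1) * ((k : ℝ) + 1) ^ 2 with hM
  have hMk : ∀ k ∈ Finset.range (K + 1), (‖T z k‖ + 1) * ((k : ℝ) + 1) ^ 2 ≤ M := fun k hk =>
    Finset.single_le_sum (f := fun k : ℕ => (‖T z k‖ + 1) * ((k : ℝ) + 1) ^ 2)
      (fun i _ => by positivity) hk
  have hM0 : 0 ≤ M := Finset.sum_nonneg fun i _ => by positivity
  have hB0 : 0 ≤ B := by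
    rw [hB]
    unfold FstarBound
    positivity
  have hsum : Summable fun k : ℕ => M * Real.exp (2 * (8 * B)) / ((k : ℝ) + 1) ^ 2 := by
    have := (summable_nat_add_iff 1).2 (Real.summable_one_div_nat_pow.2 one_lt_two)
    simpa [div_eq_mul_inv] using this.mul_left (M * Real.exp (2 * (8 * B)))
  refine (differentiableOn_tsum_of_summable_norm (F := fun k w => T w k) hsum ?_ hUo ?_)
    |>.differentiableAt (hUo.mem_nhds hzU)
  · intro k w hw
    obtain ⟨⟨h1, h2, h3, h4, h5, h6, h7⟩, -⟩ := hU w hw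
    exact (differentiableAt_FstarTerm (ha w) (hb w) (hc w) (hd w) (he w) (hf w) (hg w)
      h1 h2 h3 h4 h5 h6 h7 k).differentiableWithinAt
  · intro k w hw
    obtain ⟨⟨h1, h2, h3, h4, h5, h6, h7⟩, ⟨n1, n2, n3⟩, hb, ht⟩ := hU w hw
    rw [le_div_iff₀ (by positivity)]
    have hle : ∀ k ∈ Finset.range (K + 1), ‖T w k‖ * ((k : ℝ) + 1) ^ 2 ≤ M := fun k hk =>
      (mul_le_mul_of_nonneg_right (ht k hk) (by positivity)).trans (hMk k hk)
    rcases lt_or_ge k K with hk | hk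
    · exact (hle k (Finset.mem_range.2 (by omega))).trans
        (le_mul_of_one_le_right hM0 (Real.one_le_exp (by positivity)))
    · exact (norm_FstarTerm_le (hs w) h1 h2 h3 h4 h5 h6 h7 hK1 n1 n2 n3 hb k hk).trans
        (mul_le_mul_of_nonneg_right (hle K (Finset.self_mem_range_succ K)) (Real.exp_pos _).le)

theorem DifferentiableAt.Sn {u : ℂ → ℂ} {z : ℂ} (hu : DifferentiableAt ℂ u z) :
    DifferentiableAt ℂ (fun w => Sn (u w)) z :=
  differentiable_Sn.differentiableAt.comp z hu

theorem DifferentiableAt.Af {x y u v : ℂ → ℂ} {z : ℂ} (hx : DifferentiableAt ℂ x z)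
    (hy : DifferentiableAt ℂ y z) (hu : DifferentiableAt ℂ u z) (hv : DifferentiableAt ℂ v z)
    (ix : ∀ n : ℤ, x z ≠ n) (iy : ∀ n : ℤ, y z ≠ n) (iu : ∀ n : ℤ, u z ≠ n)
    (iv : ∀ n : ℤ, v z ≠ n) : DifferentiableAt ℂ (fun w => Af (x w) (y w) (u w) (v w)) z :=
  (differentiableAt_const 1).div ((((hx.Gamma_of_not_int ix).mul (hy.Gamma_of_not_int iy)).mul
    (hu.Gamma_of_not_int iu)).mul (hv.Gamma_of_not_int iv))
    (mul_ne_zero (mul_ne_zero (mul_ne_zero (Gamma_ne_zero' ix) (Gamma_ne_zero' iy))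
      (Gamma_ne_zero' iu)) (Gamma_ne_zero' iv))

theorem differentiableAt_Kf {a b c d e f g : ℂ → ℂ} {z : ℂ} (ha : Differentiable ℂ a)
    (hb : Differentiable ℂ b) (hc : Differentiable ℂ c) (hd : Differentiable ℂ d)
    (he : Differentiable ℂ e) (hf : Differentiable ℂ f) (hg : Differentiable ℂ g)
    (hs : ∀ w, e w + f w + g w = a w + b w + c w + d w + 1)
    (h : GenericParams (a z) (b z) (c z) (d z) (e z) (f z) (g z)) :
    DifferentiableAt ℂ (fun w => Kf (a w) (b w) (c w) (d w) (e w) (f w) (g w)) z := by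
  obtain ⟨-, hi, hd'⟩ := h
  have i0 : ∀ n : ℤ, a z ≠ n := hi 0
  have i1 : ∀ n : ℤ, b z ≠ n := hi 1
  have i2 : ∀ n : ℤ, c z ≠ n := hi 2
  have i3 : ∀ n : ℤ, d z ≠ n := hi 3
  have i4 : ∀ n : ℤ, 1 + a z - e z ≠ n := not_int_one_add_sub (hd' 4 0 (by decide))
  have i5 : ∀ n : ℤ, 1 + a z - f z ≠ n := not_int_one_add_sub (hd' 5 0 (by decide))
  have i6 : ∀ n : ℤ, 1 + a z - g z ≠ n := not_int_one_add_sub (hd' 6 0 (by decide))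
  have f4 : Differentiable ℂ fun w => 1 + a w - e w := by fun_prop
  have f5 : Differentiable ℂ fun w => 1 + a w - f w := by fun_prop
  have f6 : Differentiable ℂ fun w => 1 + a w - g w := by fun_prop
  refine DifferentiableAt.div (DifferentiableAt.add ?_ ?_) ?_ ?_
  · exact differentiableAt_Fstar ha hb hc hd he hf hg hs i0 i1 i2 i3 (hi 4) (hi 5) (hi 6)
  · exact differentiableAt_Fstar ha f4 f5 f6 (by fun_prop) (by fun_prop) (by fun_prop)
      (fun w => by linear_combination hs w) i0 i4 i5 i6 (not_int_one_add_sub (hd' 1 0 (by decide)))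
      (not_int_one_add_sub (hd' 2 0 (by decide))) (not_int_one_add_sub (hd' 3 0 (by decide)))
  · exact (((((((ha z).Sn.mul (((ha z).Gamma_of_not_int i0).pow 2)).mul
      ((hb z).Gamma_of_not_int i1)).mul ((hc z).Gamma_of_not_int i2)).mul
      ((hd z).Gamma_of_not_int i3)).mul ((f4 z).Gamma_of_not_int i4)).mul
      ((f5 z).Gamma_of_not_int i5)).mul ((f6 z).Gamma_of_not_int i6)
  · simp only [mul_ne_zero_iff, pow_ne_zero_iff two_ne_zero]
    exact ⟨⟨⟨⟨⟨⟨⟨Sn_ne_zero i0, Gamma_ne_zero' i0⟩, Gamma_ne_zero' i1⟩, Gamma_ne_zero' i2⟩,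
      Gamma_ne_zero' i3⟩, Gamma_ne_zero' i4⟩, Gamma_ne_zero' i5⟩, Gamma_ne_zero' i6⟩

theorem differentiableAt_Lf {a b c d e f g : ℂ → ℂ} {z : ℂ} (ha : Differentiable ℂ a)
    (hb : Differentiable ℂ b) (hc : Differentiable ℂ c) (hd : Differentiable ℂ d)
    (he : Differentiable ℂ e) (hf : Differentiable ℂ f) (hg : Differentiable ℂ g)
    (hs : ∀ w, e w + f w + g w = a w + b w + c w + d w + 1)
    (i0 : ∀ n : ℤ, a z ≠ n) (i1 : ∀ n : ℤ, b z ≠ n) (i2 : ∀ n : ℤ, c z ≠ n)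
    (i3 : ∀ n : ℤ, d z ≠ n) (i4 : ∀ n : ℤ, e z ≠ n) (i5 : ∀ n : ℤ, f z ≠ n)
    (i6 : ∀ n : ℤ, g z ≠ n) (j0 : ∀ n : ℤ, 1 + a z - e z ≠ n) (j1 : ∀ n : ℤ, 1 + b z - e z ≠ n)
    (j2 : ∀ n : ℤ, 1 + c z - e z ≠ n) (j3 : ∀ n : ℤ, 1 + d z - e z ≠ n)
    (j5 : ∀ n : ℤ, 1 + f z - e z ≠ n) (j6 : ∀ n : ℤ, 1 + g z - e z ≠ n) :
    DifferentiableAt ℂ (fun w => Lf (a w) (b w) (c w) (d w) (e w) (f w) (g w)) z := by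
  have f0 : Differentiable ℂ fun w => 1 + a w - e w := by fun_prop
  have f1 : Differentiable ℂ fun w => 1 + b w - e w := by fun_prop
  have f2 : Differentiable ℂ fun w => 1 + c w - e w := by fun_prop
  have f3 : Differentiable ℂ fun w => 1 + d w - e w := by fun_prop
  refine DifferentiableAt.div (DifferentiableAt.sub ?_ ?_) ?_ ?_
  · exact differentiableAt_Fstar ha hb hc hd he hf hg hs i0 i1 i2 i3 i4 i5 i6
  · exact differentiableAt_Fstar f0 f1 f2 f3 (by fun_prop) (by fun_prop) (by fun_prop)
      (fun w => by linear_combination hs w) j0 j1 j2 j3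
      (fun n hn => i4 (2 - n) (by push_cast; linear_combination -hn)) j5 j6
  · exact ((((((((he z).Sn.mul ((ha z).Gamma_of_not_int i0)).mul
      ((hb z).Gamma_of_not_int i1)).mul ((hc z).Gamma_of_not_int i2)).mul
      ((hd z).Gamma_of_not_int i3)).mul ((f0 z).Gamma_of_not_int j0)).mul
      ((f1 z).Gamma_of_not_int j1)).mul ((f2 z).Gamma_of_not_int j2)).mul
      ((f3 z).Gamma_of_not_int j3)
  · simp only [mul_ne_zero_iff]
    exact ⟨⟨⟨⟨⟨⟨⟨⟨Sn_ne_zero i4, Gamma_ne_zero' i0⟩, Gamma_ne_zero' i1⟩, Gamma_ne_zero' i2⟩,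
      Gamma_ne_zero' i3⟩, Gamma_ne_zero' j0⟩, Gamma_ne_zero' j1⟩, Gamma_ne_zero' j2⟩,
      Gamma_ne_zero' j3⟩

theorem differentiable_B1 {a b c d e f g : ℂ → ℂ} (ha : Differentiable ℂ a)
    (hb : Differentiable ℂ b) (hc : Differentiable ℂ c) (hd : Differentiable ℂ d)
    (he : Differentiable ℂ e) (hf : Differentiable ℂ f) (hg : Differentiable ℂ g) :
    Differentiable ℂ fun w => B1 (a w) (b w) (c w) (d w) (e w) (f w) (g w) := by
  unfold B1 Sn
  fun_prop

theorem differentiableAt_orbit4_summand {a b c d e f g : ℂ → ℂ} {z : ℂ} (ha : Differentiable ℂ a)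
    (hb : Differentiable ℂ b) (hc : Differentiable ℂ c) (hd : Differentiable ℂ d)
    (he : Differentiable ℂ e) (hf : Differentiable ℂ f) (hg : Differentiable ℂ g)
    (hs : ∀ w, e w + f w + g w = a w + b w + c w + d w + 1)
    (h : GenericParams (a z) (b z) (c z) (d z) (e z) (f z) (g z)) :
    DifferentiableAt ℂ (fun w => Af (1 - c w) (e w - c w) (f w - c w) (g w - c w) *
      B1 (a w) (b w) (d w) (c w) (e w) (f w) (g w) *
        Lf (1 - a w) (e w - a w) (f w - a w) (g w - a w) (1 + d w - a w) (1 + c w - a w)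
          (1 + b w - a w)) z := by
  obtain ⟨-, hi, hd'⟩ := h
  have hsub : ∀ i j : Fin 7, i ≠ j → ∀ n : ℤ,
      1 + ![a z, b z, c z, d z, e z, f z, g z] i - ![a z, b z, c z, d z, e z, f z, g z] j ≠ n :=
    fun i j hij => not_int_one_add_sub (hd' j i hij.symm)
  have cancel : ∀ x y : ℂ, (∀ n : ℤ, x ≠ n) → x = y → ∀ n : ℤ, y ≠ n := by
    rintro x y h rfl
    exact h
  refine DifferentiableAt.mul (DifferentiableAt.mul ?_ ?_) ?_
  · exact DifferentiableAt.Af (by fun_prop) (by fun_prop) (by fun_prop) (by fun_prop)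
      (not_int_one_sub (hi 2)) (hd' 4 2 (by decide)) (hd' 5 2 (by decide)) (hd' 6 2 (by decide))
  · exact differentiable_B1 ha hb hd hc he hf hg z
  · exact differentiableAt_Lf (by fun_prop) (by fun_prop) (by fun_prop) (by fun_prop)
      (by fun_prop) (by fun_prop) (by fun_prop) (fun w => by linear_combination -hs w)
      (not_int_one_sub (hi 0)) (hd' 4 0 (by decide)) (hd' 5 0 (by decide)) (hd' 6 0 (by decide))
      (hsub 3 0 (by decide)) (hsub 2 0 (by decide)) (hsub 1 0 (by decide))
      (cancel _ _ (not_int_one_sub (hi 3)) (by simp; ring))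
      (cancel _ _ (hd' 4 3 (by decide)) (by simp; ring))
      (cancel _ _ (hd' 5 3 (by decide)) (by simp; ring))
      (cancel _ _ (hd' 6 3 (by decide)) (by simp; ring))
      (cancel _ _ (hsub 2 3 (by decide)) (by simp; ring))
      (cancel _ _ (hsub 1 3 (by decide)) (by simp; ring))

theorem differentiableAt_orbit4Expr {a b c d e f g : ℂ → ℂ} {z : ℂ} (ha : Differentiable ℂ a)
    (hb : Differentiable ℂ b) (hc : Differentiable ℂ c) (hd : Differentiable ℂ d)
    (he : Differentiable ℂ e) (hf : Differentiable ℂ f) (hg : Differentiable ℂ g)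
    (hs : ∀ w, e w + f w + g w = a w + b w + c w + d w + 1)
    (h : GenericParams (a z) (b z) (c z) (d z) (e z) (f z) (g z)) :
    DifferentiableAt ℂ (fun w => orbit4Expr (a w) (b w) (c w) (d w) (e w) (f w) (g w)) z := by
  have hL := differentiableAt_orbit4_summand ha hb hc hd he hf hg hs h
  have hR := differentiableAt_orbit4_summand ha hb hd hc he hf hg
    (fun w => by linear_combination hs w) h.swap
  simp only [Lf_swap (1 - a _) _ _ _ _ (1 + d _ - a _)] at hR
  have hK := differentiableAt_Kf ha hb hc hd he hf hg hs h
  obtain ⟨-, hi, hd'⟩ := h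
  refine DifferentiableAt.add (DifferentiableAt.sub (DifferentiableAt.mul (DifferentiableAt.mul
    (DifferentiableAt.mul (DifferentiableAt.mul ?_ ?_) ?_) ?_) hK) hL) hR
  · exact DifferentiableAt.Sn (by fun_prop)
  · exact DifferentiableAt.Af (by fun_prop) (by fun_prop) (by fun_prop) (by fun_prop)
      (not_int_one_sub (hi 0)) (hd' 4 0 (by decide)) (hd' 5 0 (by decide)) (hd' 6 0 (by decide))
  · exact DifferentiableAt.Af (by fun_prop) (by fun_prop) (by fun_prop) (by fun_prop)
      (not_int_one_sub (hi 0)) (not_int_one_sub (hi 1)) (not_int_one_sub (hi 2))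
      (not_int_one_sub (hi 3))
  · exact DifferentiableAt.Af (by fun_prop) (by fun_prop) (by fun_prop) (by fun_prop)
      (hi 1) (not_int_one_add_sub (hd' 4 1 (by decide)))
      (not_int_one_add_sub (hd' 5 1 (by decide))) (not_int_one_add_sub (hd' 6 1 (by decide)))

theorem setOf_affine_int_countable {u v : ℂ} (h : ∀ n : ℤ, u + v ≠ n) :
    {z : ℂ | ∃ n : ℤ, u + z * v = n}.Countable := by
  rw [Set.ofPred_exists]
  refine Set.countable_iUnion fun n => Set.Subsingleton.countable ?_
  intro z hz w hw
  simp only [Set.mem_ofPred_eq] at hz hw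
  have hv : v ≠ 0 := by
    rintro rfl
    exact h n (by linear_combination hz)
  exact mul_right_cancel₀ hv (by linear_combination hz - hw)

/-- A parameter point satisfying the inequalities of `orbit4_region`. -/
def basePoint : Fin 7 → ℂ := ![1 / 2, -3 / 10, 2 / 5, 2 / 5, 2 / 3, 2 / 3, 2 / 3]

theorem orbit4_eq_zero {a b c d e f g : ℂ} (h : GenericParams a b c d e f g) :
    orbit4Expr a b c d e f g = 0 := by
  set p : ℂ → Fin 7 → ℂ := fun z i =>
    basePoint i + z * (![a, b, c, d, e, f, g] i - basePoint i) with hp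
  have hp1 : p 1 = ![a, b, c, d, e, f, g] := by
    funext i
    simp only [hp]
    ring
  have hpd : ∀ i, Differentiable ℂ fun z => p z i := fun i => by
    simp only [hp]
    fun_prop
  have hps : ∀ z, p z 4 + p z 5 + p z 6 = p z 0 + p z 1 + p z 2 + p z 3 + 1 := by
    intro z
    simp only [hp, basePoint, Matrix.cons_val]
    linear_combination z * h.sum
  set U : Set ℂ := {z | (∀ i, ∀ n : ℤ, p z i ≠ n) ∧
    ∀ i j, i ≠ j → ∀ n : ℤ, p z i - p z j ≠ n} with hU
  have hvec : ∀ z, ![p z 0, p z 1, p z 2, p z 3, p z 4, p z 5, p z 6] = p z := by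
    intro z
    funext i
    fin_cases i <;> rfl
  have hgen : ∀ z ∈ U, GenericParams (p z 0) (p z 1) (p z 2) (p z 3) (p z 4) (p z 5) (p z 6) := by
    intro z hz
    refine ⟨hps z, ?_, ?_⟩
    · rw [hvec]; exact hz.1
    · rw [hvec]; exact hz.2
  have hUo : IsOpen U := by
    rw [isOpen_iff_eventually]
    intro z hz
    refine Eventually.and ?_ ?_
    · exact eventually_all.2 fun i => eventually_not_int (hpd i).continuous.continuousAt (hz.1 i)
    · refine eventually_all.2 fun i => eventually_all.2 fun j => eventually_imp_distrib_left.2 ?_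
      intro hij
      exact eventually_not_int ((hpd i).sub (hpd j)).continuous.continuousAt (hz.2 i j hij)
  have h1U : (1 : ℂ) ∈ U := by
    simp only [hU, Set.mem_ofPred_eq, hp1]
    exact ⟨h.not_int, h.not_int_sub⟩
  have hUc : (Uᶜ).Countable := by
    have hsub : Uᶜ ⊆ (⋃ i, {z | ∃ n : ℤ, p z i = n}) ∪
        ⋃ i, ⋃ j, {z | i ≠ j ∧ ∃ n : ℤ, p z i - p z j = n} := by
      intro z hz
      simp only [hU, Set.mem_compl_iff, Set.mem_ofPred_eq, not_and_or, not_forall, not_not] at hz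
      rcases hz with ⟨i, n, hn⟩ | ⟨i, j, hij, n, hn⟩
      · exact Or.inl (Set.mem_iUnion.2 ⟨i, n, hn⟩)
      · exact Or.inr (Set.mem_iUnion₂.2 ⟨i, j, hij, n, hn⟩)
    refine Set.Countable.mono hsub (Set.Countable.union (Set.countable_iUnion fun i => ?_)
      (Set.countable_iUnion fun i => Set.countable_iUnion fun j => ?_))
    · exact setOf_affine_int_countable fun n => by
        simpa using h.not_int i n
    · by_cases hij : i = j
      · simp [hij]
      refine (setOf_affine_int_countable (u := basePoint i - basePoint j)
        (v := ![a, b, c, d, e, f, g] i - basePoint i - (![a, b, c, d, e, f, g] j - basePoint j))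
        fun n hn => h.not_int_sub i j hij n (by linear_combination hn)).mono ?_
      rintro z ⟨-, n, hn⟩
      exact ⟨n, by linear_combination hn⟩
  have hrank : 1 < Module.rank ℝ ℂ := by
    rw [Complex.rank_real_complex]
    exact Cardinal.one_lt_two
  have hUconn : IsPreconnected U := by
    rw [← compl_compl U]
    exact (hUc.isConnected_compl_of_one_lt_rank hrank).isPreconnected
  have hUdense : Dense U := by
    rw [← compl_compl U]
    exact hUc.dense_compl ℝ
  set F : ℂ → ℂ := fun z => orbit4Expr (p z 0) (p z 1) (p z 2) (p z 3) (p z 4) (p z 5) (p z 6)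
    with hF
  have hFan : AnalyticOnNhd ℂ F U := DifferentiableOn.analyticOnNhd (fun z hz =>
    (differentiableAt_orbit4Expr (hpd 0) (hpd 1) (hpd 2) (hpd 3) (hpd 4) (hpd 5) (hpd 6) hps
      (hgen z hz)).differentiableWithinAt) hUo
  have hre : ∀ i, Continuous fun z => (p z i).re := fun i =>
    continuous_re.comp (hpd i).continuous
  have hp0 : p 0 = basePoint := by
    funext i
    simp [hp]
  have hclose : ∀ᶠ z in 𝓝 (0 : ℂ), ∀ i, |(p z i).re - (basePoint i).re| < 1 / 100 := by
    refine eventually_all.2 fun i => ?_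
    refine ContinuousAt.eventually_lt (((hre i).sub continuous_const).abs.continuousAt)
      continuousAt_const ?_
    simp [hp0]
  have hzero : ∀ᶠ z in 𝓝 (0 : ℂ), z ∈ U → F z = 0 := by
    filter_upwards [hclose] with z hz hzU
    have hsre := congrArg Complex.re (hps z)
    simp only [add_re, one_re] at hsre
    have z0 := abs_lt.1 (hz 0)
    have z1 := abs_lt.1 (hz 1)
    have z2 := abs_lt.1 (hz 2)
    have z3 := abs_lt.1 (hz 3)
    have z4 := abs_lt.1 (hz 4)
    have z5 := abs_lt.1 (hz 5)
    have z6 := abs_lt.1 (hz 6)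
    simp only [basePoint, Matrix.cons_val] at z0 z1 z2 z3 z4 z5 z6
    norm_num at z0 z1 z2 z3 z4 z5 z6
    refine orbit4_region (hgen z hzU) ?_ ?_ ?_ ?_ ?_ ?_ ?_ ?_ ?_ ?_ ?_ ?_ ?_ ?_ ?_ ?_ ?_
    · constructor
      · simp; linarith
      · simp; linarith
      · simp; linarith
      · simp
      · intro i; fin_cases i <;> simp <;> linarith
      · intro i; fin_cases i <;> simp <;> linarith
      · intro i; fin_cases i <;> simp <;> linarith
      · simp; linarith
    all_goals simp; linarith
  obtain ⟨V, hV, hVo, h0V⟩ := eventually_nhds_iff.1 hzero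
  obtain ⟨z₀, hz₀V, hz₀U⟩ := hUdense.inter_open_nonempty V hVo ⟨0, h0V⟩
  have hev : F =ᶠ[𝓝 z₀] 0 := by
    filter_upwards [hVo.mem_nhds hz₀V, hUo.mem_nhds hz₀U] with z hzV hzU
    exact hV z hzV hzU
  have := hFan.eqOn_zero_of_preconnected_of_eventuallyEq_zero hUconn hz₀U hev h1U
  simpa [hF, hp1] using this

theorem orbit4_KLL_relation (a b c d e f g : ℂ)
    (hsaal : e + f + g = a + b + c + d + 1)
    (hint : ∀ i : Fin 7, ∀ n : ℤ, ![a, b, c, d, e, f, g] i ≠ (n : ℂ))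
    (hdiff : ∀ i j : Fin 7, i ≠ j → ∀ n : ℤ,
      ![a, b, c, d, e, f, g] i - ![a, b, c, d, e, f, g] j ≠ (n : ℂ)) :
    Sn (d - c) * Af (1 - a) (e - a) (f - a) (g - a) * Af (1 - a) (1 - b) (1 - c) (1 - d) *
        Af b (1 + b - e) (1 + b - f) (1 + b - g) * Kf a b c d e f g -
      Af (1 - c) (e - c) (f - c) (g - c) * B1 a b d c e f g *
        Lf (1 - a) (e - a) (f - a) (g - a) (1 + d - a) (1 + c - a) (1 + b - a) +
      Af (1 - d) (e - d) (f - d) (g - d) * B1 a b c d e f g *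
        Lf (1 - a) (e - a) (f - a) (g - a) (1 + c - a) (1 + b - a) (1 + d - a) = 0 :=
  orbit4_eq_zero ⟨hsaal, hint, hdiff⟩
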